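/- arXiv:0810.4664 — 3 statements merged into one kernel-verified Lean document; each statement's English description precedes it below -/
import Mathlib

section
/- For k ∈ ℕ₀ and p > d, there exist a constant c = c(k,p,d) > 0 and an exponent α_k ∈ ℕ₀ such that for all u ∈ W^{k+2,p}(ℝ^d;ℝ^d) and all X ∈ 𝕏^{k+2,p} that preserve Lebesgue measure (i.e. det(∇X) = 1), one has ‖∇(u∘X)‖_{k+1,p} ≤ c ‖∇u‖_{k+1,p} (1 + ‖∇X‖_∞^{k+2} + ‖∇²X‖_{k,p}^{α_k}). -/
open MeasureTheory ProbabilityTheory Filter Set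
open scoped ENNReal NNReal Topology

noncomputable section

abbrev Euc (d : ℕ) := EuclideanSpace ℝ (Fin d)

/-- `i`-th standard basis vector of `ℝ^d`. -/
def ee {d : ℕ} (i : Fin d) : Euc d := EuclideanSpace.single i 1

/-- Divergence `∇·u` of a vector field. -/
def divg {d : ℕ} (u : Euc d → Euc d) (x : Euc d) : ℝ :=
  ∑ i, fderiv ℝ u x (ee i) i

/-- Action of the transposed Jacobi matrix `∇^t u (x)`. -/
def tJac {d : ℕ} (u : Euc d → Euc d) (x : Euc d) : Euc d →L[ℝ] Euc d :=
  ContinuousLinearMap.adjoint (fderiv ℝ u x)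

/-- Supremum norm (valued in `ℝ≥0∞`). -/
def supNorm {α F : Type*} [NormedAddCommGroup F] (f : α → F) : ℝ≥0∞ :=
  ⨆ x, (‖f x‖₊ : ℝ≥0∞)

/-- `∑_{j=a}^{b} ‖∇^j f‖_{L^p}`; e.g. `wNorm 0 k p f` is the Sobolev norm
`‖f‖_{k,p}` and `wNorm 1 (k+1) p f` is `‖∇f‖_{k,p}`. -/
def wNorm {d : ℕ} {F : Type*} [NormedAddCommGroup F] [NormedSpace ℝ F]
    (a b : ℕ) (p : ℝ) (f : Euc d → F) : ℝ≥0∞ :=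
  ∑ j ∈ Finset.Icc a b, eLpNorm (iteratedFDeriv ℝ j f) (ENNReal.ofReal p) volume

/-- Membership in the Sobolev space `W^{k,p}(ℝ^d)`. -/
def MemW {d : ℕ} {F : Type*} [NormedAddCommGroup F] [NormedSpace ℝ F]
    (k : ℕ) (p : ℝ) (f : Euc d → F) : Prop :=
  ContDiff ℝ k f ∧ wNorm 0 k p f < ∞

/-- Membership in the Banach space `𝕏^{k+2,p}` of transformations of `ℝ^d`. -/
def MemX {d : ℕ} (k : ℕ) (p : ℝ) (X : Euc d → Euc d) : Prop :=
  ContDiff ℝ (k+2) X ∧ supNorm (fderiv ℝ X) < ∞ ∧ wNorm 2 (k+2) p X < ∞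

/-- Characterizing properties of the Leray–Hodge projection `P = I - ∇(-Δ)⁻¹ div`:
it differs from the identity by a gradient, kills gradients, produces
divergence-free fields, and is `L^p`-bounded for all `1 < p < ∞`. -/
def IsLerayProjection {d : ℕ} (P : (Euc d → Euc d) → (Euc d → Euc d)) : Prop :=
  (∀ f, ∃ q : Euc d → ℝ, ∀ x, f x = P f x + gradient q x) ∧
  (∀ q : Euc d → ℝ, Differentiable ℝ q → P (fun x => gradient q x) = 0) ∧
  (∀ f, Differentiable ℝ (P f) → ∀ x, divg (P f) x = 0) ∧
  (∀ p : ℝ, 1 < p → ∃ C : ℝ≥0, 0 < C ∧ ∀ f,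
    eLpNorm (P f) (ENNReal.ofReal p) volume ≤ C * eLpNorm f (ENNReal.ofReal p) volume)

/-- A standard `d`-dimensional Brownian motion (indexed by `ℝ`). -/
structure IsBrownianMotion {Ω : Type*} [MeasureSpace Ω] {d : ℕ}
    (W : ℝ → Ω → Euc d) : Prop where
  meas : ∀ t, Measurable (W t)
  start : ∀ᵐ ω ∂(ℙ : Measure Ω), W 0 ω = 0
  cont : ∀ᵐ ω ∂(ℙ : Measure Ω), Continuous fun t => W t ω
  coord_indep : ∀ s t : ℝ, s ≤ t →
    iIndepFun (fun (i : Fin d) ω => W t ω i - W s ω i) ℙ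
  incr_indep : ∀ (n : ℕ) (ts : Fin (n+1) → ℝ), Monotone ts →
    iIndepFun
      (fun (k : Fin n) ω => W (ts k.succ) ω - W (ts k.castSucc) ω) ℙ
  gauss : ∀ s t : ℝ, s ≤ t → ∀ i : Fin d,
    Measure.map (fun ω => W t ω i - W s ω i) ℙ = gaussianReal 0 (Real.toNNReal (t - s))

/-- Vector-valued Laplacian `Δf`. -/
def vLap {d : ℕ} (f : Euc d → Euc d) (x : Euc d) : Euc d :=
  ∑ i, iteratedFDeriv ℝ 2 f x ![ee i, ee i]


lemma scaled_bound {d : ℕ} (p : ℝ) (hp : 1 ≤ p) {G : Type*} [NormedAddCommGroup G]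
    (g : Euc d → G) (hg : Continuous g) (x : Euc d) (t : ℝ) (ht : 0 < t) :
    ∫⁻ z in Metric.ball (0 : Euc d) 1, ‖g (x + t • z)‖ₑ ≤
      ENNReal.ofReal (t ^ (-(d : ℝ) / p)) * eLpNorm g (ENNReal.ofReal p) volume *
        volume (Metric.ball (0 : Euc d) 1) ^ (1 - 1 / p) := by
  have hp0 : 0 < p := by linarith
  have hP : (ENNReal.ofReal p).toReal = p := ENNReal.toReal_ofReal hp0.le
  have hgc : Continuous (fun z => g (x + t • z)) := by fun_prop
  have h1 := eLpNorm_le_eLpNorm_mul_rpow_measure_univ (p := 1) (q := ENNReal.ofReal p)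
    (μ := volume.restrict (Metric.ball (0 : Euc d) 1)) (f := fun z => g (x + t • z))
    (by simpa using hp) hgc.aestronglyMeasurable
  rw [eLpNorm_one_eq_lintegral_enorm, hP, Measure.restrict_apply_univ] at h1
  refine h1.trans ?_
  simp only [ENNReal.toReal_one, div_one]
  gcongr
  refine (eLpNorm_mono_measure _ Measure.restrict_le_self).trans ?_
  have h2 : eLpNorm (fun z => g (x + t • z)) (ENNReal.ofReal p) volume
      = eLpNorm (fun z => g (x + z)) (ENNReal.ofReal p)
        (Measure.map (fun z : Euc d => t • z) volume) := by
    rw [eLpNorm_map_measure]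
    · rfl
    · exact (show Continuous fun z => g (x + z) by fun_prop).aestronglyMeasurable
    · fun_prop
  have h3 : Measure.map (fun z : Euc d => t • z) volume = 
      ENNReal.ofReal |(t ^ d)⁻¹| • (volume : Measure (Euc d)) := by
    have := Measure.map_addHaar_smul (volume : Measure (Euc d)) ht.ne'
    simpa using this
  rw [h2, h3, eLpNorm_smul_measure_of_ne_top ENNReal.ofReal_ne_top]
  have h4 : eLpNorm (fun z => g (x + z)) (ENNReal.ofReal p) volume
      = eLpNorm g (ENNReal.ofReal p) volume :=
    eLpNorm_comp_measurePreserving hg.aestronglyMeasurable (measurePreserving_add_left volume x)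
  rw [h4, smul_eq_mul]
  gcongr
  rw [ENNReal.toReal_div, hP, ENNReal.toReal_one, ENNReal.ofReal_rpow_of_nonneg (by positivity) (by positivity)]
  apply le_of_eq
  congr 1
  rw [abs_of_pos (by positivity), ← Real.rpow_natCast, ← Real.rpow_neg ht.le, ← Real.rpow_mul ht.le]
  congr 1
  ring

lemma morrey (d : ℕ) (p : ℝ) (hp : (d : ℝ) < p) (hp1 : 1 ≤ p) :
    ∃ C : ℝ≥0, ∀ (F : Type) [NormedAddCommGroup F] [NormedSpace ℝ F] [CompleteSpace F]
      (f : Euc d → F), ContDiff ℝ 1 f → ∀ x,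
      ‖f x‖ₑ ≤ C * (eLpNorm f (ENNReal.ofReal p) volume +
        eLpNorm (fderiv ℝ f) (ENNReal.ofReal p) volume) := by
  have hp0 : 0 < p := by linarith
  set V := volume (Metric.ball (0 : Euc d) 1) with hV
  have hV0 : V ≠ 0 := (Metric.measure_ball_pos volume _ one_pos).ne'
  have hVt : V ≠ ∞ := measure_ball_lt_top.ne
  set I : ℝ≥0∞ := ∫⁻ t in Ioc (0:ℝ) 1, ENNReal.ofReal (t ^ (-(d : ℝ) / p)) with hI
  have hIt : I ≠ ∞ := by
    have h : IntervalIntegrable (fun t : ℝ => t ^ (-(d : ℝ) / p)) volume 0 1 := by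
      apply intervalIntegral.intervalIntegrable_rpow'
      rw [neg_div, neg_lt_neg_iff, div_lt_one hp0]
      exact hp
    rw [intervalIntegrable_iff_integrableOn_Ioc_of_le zero_le_one] at h
    exact (Integrable.lintegral_lt_top h).ne
  have hKt : V⁻¹ * V ^ (1 - 1 / p) * (1 + I) ≠ ∞ := by
    refine ENNReal.mul_ne_top (ENNReal.mul_ne_top (ENNReal.inv_ne_top.2 hV0) ?_) ?_
    · exact ENNReal.rpow_ne_top_of_ne_zero hV0 hVt
    · exact ENNReal.add_ne_top.2 ⟨ENNReal.one_ne_top, hIt⟩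
  refine ⟨(V⁻¹ * V ^ (1 - 1 / p) * (1 + I)).toNNReal, ?_⟩
  intro F _ _ _ f hf x
  rw [ENNReal.coe_toNNReal hKt]
  have hf' : Continuous (fderiv ℝ f) := hf.continuous_fderiv (by norm_num)
  set P := ENNReal.ofReal p
  have key : ∀ z ∈ Metric.ball (0 : Euc d) 1, ‖f x‖ₑ ≤ ‖f (x + (1:ℝ) • z)‖ₑ +
      ∫⁻ t in Ioc (0:ℝ) 1, ‖fderiv ℝ f (x + t • z)‖ₑ := by
    intro z hz
    have hz1 : ‖z‖ₑ ≤ 1 := by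
      rw [mem_ball_zero_iff] at hz
      rw [← ofReal_norm]
      exact ENNReal.ofReal_le_one.2 hz.le
    have hc : Continuous fun t : ℝ => fderiv ℝ f (x + t • z) z := by fun_prop
    have hd : ∀ t ∈ uIcc (0:ℝ) 1, HasDerivAt (fun t : ℝ => f (x + t • z))
        (fderiv ℝ f (x + t • z) z) t := by
      intro t _
      have h1 : HasFDerivAt f (fderiv ℝ f (x + t • z)) (x + t • z) :=
        ((hf.differentiable (by norm_num)) _).hasFDerivAt
      have h2 : HasDerivAt (fun t : ℝ => x + t • z) z t := by
        simpa using ((hasDerivAt_id t).smul_const z).const_add x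
      exact h1.comp_hasDerivAt t h2
    have h := intervalIntegral.integral_eq_sub_of_hasDerivAt hd (hc.intervalIntegrable 0 1)
    rw [intervalIntegral.integral_of_le zero_le_one] at h
    simp only [zero_smul, add_zero] at h
    have h2 : f x = f (x + (1:ℝ) • z) - ∫ t in Ioc (0:ℝ) 1, fderiv ℝ f (x + t • z) z := by
      rw [h]; abel
    conv_lhs => rw [h2]
    refine (enorm_sub_le).trans ?_
    gcongr
    refine (enorm_integral_le_lintegral_enorm _).trans ?_
    refine lintegral_mono fun t => ?_
    refine ((fderiv ℝ f (x + t • z)).le_opENorm z).trans ?_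
    calc _ ≤ ‖fderiv ℝ f (x + t • z)‖ₑ * 1 := by gcongr
      _ = _ := mul_one _
  have hm1 : Measurable fun z : Euc d => ‖f (x + (1:ℝ) • z)‖ₑ := by
    have : Continuous fun z : Euc d => f (x + (1:ℝ) • z) := by
      have := hf.continuous
      fun_prop
    exact this.enorm.measurable
  have main : V * ‖f x‖ₑ ≤ V ^ (1 - 1 / p) * (1 + I) * (eLpNorm f P volume +
        eLpNorm (fderiv ℝ f) P volume) := by
    calc V * ‖f x‖ₑ = ∫⁻ z in Metric.ball (0 : Euc d) 1, ‖f x‖ₑ := by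
          rw [setLIntegral_const, mul_comm]
      _ ≤ ∫⁻ z in Metric.ball (0 : Euc d) 1, (‖f (x + (1:ℝ) • z)‖ₑ +
            ∫⁻ t in Ioc (0:ℝ) 1, ‖fderiv ℝ f (x + t • z)‖ₑ) :=
          setLIntegral_mono' measurableSet_ball key
      _ = (∫⁻ z in Metric.ball (0 : Euc d) 1, ‖f (x + (1:ℝ) • z)‖ₑ) +
          ∫⁻ t in Ioc (0:ℝ) 1, ∫⁻ z in Metric.ball (0 : Euc d) 1, ‖fderiv ℝ f (x + t • z)‖ₑ := by
          rw [lintegral_add_left hm1, lintegral_lintegral_swap]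
          have : Continuous (Function.uncurry fun (z : Euc d) (t : ℝ) => fderiv ℝ f (x + t • z)) := by
            unfold Function.uncurry
            fun_prop
          exact this.enorm.measurable.aemeasurable
      _ ≤ ENNReal.ofReal ((1:ℝ) ^ (-(d : ℝ) / p)) * eLpNorm f P volume * V ^ (1 - 1 / p) +
          ∫⁻ t in Ioc (0:ℝ) 1, ENNReal.ofReal (t ^ (-(d : ℝ) / p)) *
            (eLpNorm (fderiv ℝ f) P volume * V ^ (1 - 1 / p)) := by
          refine add_le_add (scaled_bound p hp1 f hf.continuous x 1 one_pos) ?_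
          refine setLIntegral_mono' measurableSet_Ioc fun t ht => ?_
          rw [← mul_assoc]
          exact scaled_bound p hp1 _ hf' x t ht.1
      _ = eLpNorm f P volume * V ^ (1 - 1 / p) +
            I * (eLpNorm (fderiv ℝ f) P volume * V ^ (1 - 1 / p)) := by
          rw [lintegral_mul_const _ (by fun_prop), Real.one_rpow, ENNReal.ofReal_one, one_mul]
      _ ≤ _ := by
          have h1 : eLpNorm f P volume * V ^ (1 - 1 / p) + 
            I * (eLpNorm (fderiv ℝ f) P volume * V ^ (1 - 1 / p)) +
            (eLpNorm (fderiv ℝ f) P volume * V ^ (1 - 1 / p) + I * (eLpNorm f P volume * V ^ (1 - 1 / p))) = V ^ (1 - 1 / p) * (1 + I) * (eLpNorm f P volume +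
        eLpNorm (fderiv ℝ f) P volume) := by ring
          rw [← h1]
          exact le_self_add
  calc ‖f x‖ₑ = V⁻¹ * (V * ‖f x‖ₑ) := by
        rw [← mul_assoc, ENNReal.inv_mul_cancel hV0 hVt, one_mul]
    _ ≤ V⁻¹ * (V ^ (1 - 1 / p) * (1 + I) * (eLpNorm f P volume +
        eLpNorm (fderiv ℝ f) P volume)) := by gcongr
    _ = _ := by ring

lemma pointwise_comp {d : ℕ} (k n : ℕ) (hn : n ≤ k + 1) (u X : Euc d → Euc d)
    (hu : ContDiff ℝ (k + 2) u) (hX : ContDiff ℝ (k + 2) X) (D S : ℝ) (hD1 : 1 ≤ D)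
    (hS0 : 0 ≤ S)
    (hD : ∀ j, 1 ≤ j → j ≤ k + 1 → ∀ x, ‖iteratedFDeriv ℝ j X x‖ ≤ D)
    (hS : ∀ y, ‖fderiv ℝ u y‖ ≤ S) (x : Euc d) :
    ‖iteratedFDeriv ℝ (n + 1) (u ∘ X) x‖ ≤ 2 ^ n * (n.factorial : ℝ) *
      (D ^ (k + 2) * ∑ j ∈ Finset.Icc 1 (k + 2), ‖iteratedFDeriv ℝ j u (X x)‖ +
        S * ∑ j ∈ Finset.Icc 2 (k + 2), ‖iteratedFDeriv ℝ j X x‖) := by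
  set G := ∑ j ∈ Finset.Icc 1 (k + 2), ‖iteratedFDeriv ℝ j u (X x)‖ with hG
  set H := ∑ j ∈ Finset.Icc 2 (k + 2), ‖iteratedFDeriv ℝ j X x‖ with hH
  have hG0 : 0 ≤ G := Finset.sum_nonneg fun _ _ => norm_nonneg _
  have hH0 : 0 ≤ H := Finset.sum_nonneg fun _ _ => norm_nonneg _
  have hGj : ∀ j, 1 ≤ j → j ≤ k + 2 → ‖iteratedFDeriv ℝ j u (X x)‖ ≤ G := fun j h1 h2 =>
    Finset.single_le_sum (f := fun j => ‖iteratedFDeriv ℝ j u (X x)‖)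
      (fun _ _ => norm_nonneg _) (Finset.mem_Icc.2 ⟨h1, h2⟩)
  have hHj : ∀ j, 2 ≤ j → j ≤ k + 2 → ‖iteratedFDeriv ℝ j X x‖ ≤ H := fun j h1 h2 =>
    Finset.single_le_sum (f := fun j => ‖iteratedFDeriv ℝ j X x‖)
      (fun _ _ => norm_nonneg _) (Finset.mem_Icc.2 ⟨h1, h2⟩)
  have hDu : ContDiff ℝ ((k + 1 : ℕ) : WithTop ℕ∞) (fderiv ℝ u) :=
    hu.fderiv_right (by push_cast; rw [add_assoc, one_add_one_eq_two])
  have hDX : ContDiff ℝ ((k + 1 : ℕ) : WithTop ℕ∞) (fderiv ℝ X) :=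
    hX.fderiv_right (by push_cast; rw [add_assoc, one_add_one_eq_two])
  have hX1 : ContDiff ℝ ((k + 1 : ℕ) : WithTop ℕ∞) X :=
    hX.of_le (by exact_mod_cast (by omega : k + 1 ≤ k + 2))
  have hud : Differentiable ℝ u := hu.differentiable (by norm_cast)
  have hXd : Differentiable ℝ X := hX.differentiable (by norm_cast)
  have hcomp : fderiv ℝ (u ∘ X) = fun y => ContinuousLinearMap.compL ℝ (Euc d) (Euc d) (Euc d)
      ((fderiv ℝ u ∘ X) y) (fderiv ℝ X y) := by
    funext y
    rw [fderiv_comp y (hud _) (hXd _)]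
    rfl
  rw [← norm_iteratedFDeriv_fderiv, hcomp]
  refine (ContinuousLinearMap.norm_iteratedFDeriv_le_of_bilinear_of_le_one _ (hDu.comp hX1) hDX x
    (n := n) (by exact_mod_cast hn) (ContinuousLinearMap.norm_compL_le ..)).trans ?_
  have hterm : ∀ i ∈ Finset.range (n + 1),
      (n.choose i : ℝ) * ‖iteratedFDeriv ℝ i (fderiv ℝ u ∘ X) x‖ *
        ‖iteratedFDeriv ℝ (n - i) (fderiv ℝ X) x‖ ≤
      (n.choose i : ℝ) * ((n.factorial : ℝ) * (D ^ (k + 2) * G + S * H)) := by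
    intro i hi
    have hi' : i ≤ n := by simpa [Nat.lt_succ_iff] using hi
    rw [mul_assoc]
    refine mul_le_mul_of_nonneg_left ?_ (by positivity)
    rw [norm_iteratedFDeriv_fderiv]
    have hfac : (1 : ℝ) ≤ n.factorial := by exact_mod_cast Nat.succ_le_of_lt n.factorial_pos
    by_cases h : n - i + 1 ≤ k + 1
    · have h1 : ‖iteratedFDeriv ℝ i (fderiv ℝ u ∘ X) x‖ ≤ i.factorial * G * D ^ i := by
        refine norm_iteratedFDeriv_comp_le hDu hX1 (by exact_mod_cast hi'.trans hn) x ?_ ?_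
        · intro j hj
          rw [norm_iteratedFDeriv_fderiv]
          exact hGj _ (by omega) (by omega)
        · intro j hj1 hj2
          exact (hD j hj1 (by omega) x).trans (le_self_pow₀ hD1 (by omega))
      have h2 := hD (n - i + 1) (by omega) h x
      have h3 : (i.factorial : ℝ) ≤ n.factorial := by exact_mod_cast Nat.factorial_le hi'
      have h4 : D ^ (i + 1) ≤ D ^ (k + 2) := pow_le_pow_right₀ hD1 (by omega)
      calc _ ≤ (i.factorial * G * D ^ i) * D := by gcongr
        _ = i.factorial * (D ^ (i + 1) * G) := by ring
        _ ≤ n.factorial * (D ^ (k + 2) * G) := by gcongr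
        _ ≤ _ := by
          gcongr
          have := mul_nonneg hS0 hH0
          linarith
    · have hi0 : i = 0 := by omega
      have hnk : n = k + 1 := by omega
      subst hi0
      rw [norm_iteratedFDeriv_zero]
      have h1 := hS (X x)
      have h2 := hHj (n + 1) (by omega) (by omega)
      have h5 : 0 ≤ D ^ (k + 2) * G := by positivity
      have h6 : 0 ≤ S * H := mul_nonneg hS0 hH0
      calc _ ≤ S * H := by
            simp only [Function.comp, Nat.sub_zero]
            gcongr
        _ ≤ 1 * (D ^ (k + 2) * G + S * H) := by linarith
        _ ≤ _ := by gcongr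
  refine (Finset.sum_le_sum hterm).trans ?_
  rw [← Finset.sum_mul]
  have : (∑ i ∈ Finset.range (n + 1), (n.choose i : ℝ)) = 2 ^ n := by
    exact_mod_cast Nat.sum_range_choose n
  rw [this, mul_assoc]

lemma wNorm_ge {d : ℕ} {F : Type*} [NormedAddCommGroup F] [NormedSpace ℝ F]
    (a b : ℕ) (p : ℝ) (f : Euc d → F) (j : ℕ) (h1 : a ≤ j) (h2 : j + 1 ≤ b) :
    eLpNorm (iteratedFDeriv ℝ j f) (ENNReal.ofReal p) volume +
      eLpNorm (iteratedFDeriv ℝ (j + 1) f) (ENNReal.ofReal p) volume ≤ wNorm a b p f := by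
  have : ({j, j + 1} : Finset ℕ) ⊆ Finset.Icc a b := by
    intro i hi
    simp only [Finset.mem_insert, Finset.mem_singleton] at hi
    rw [Finset.mem_Icc]
    omega
  rw [wNorm, ← Finset.sum_pair (f := fun j => eLpNorm (iteratedFDeriv ℝ j f)
    (ENNReal.ofReal p) volume) (by omega : j ≠ j + 1)]
  exact Finset.sum_le_sum_of_subset this

lemma sup_iter {d : ℕ} (p : ℝ) (C : ℝ≥0)
    (hC : ∀ (F : Type) [NormedAddCommGroup F] [NormedSpace ℝ F] [CompleteSpace F]
      (f : Euc d → F), ContDiff ℝ 1 f → ∀ x,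
      ‖f x‖ₑ ≤ C * (eLpNorm f (ENNReal.ofReal p) volume +
        eLpNorm (fderiv ℝ f) (ENNReal.ofReal p) volume))
    (a b : ℕ) (f : Euc d → Euc d) (hf : ContDiff ℝ b f) (j : ℕ) (h1 : a ≤ j) (h2 : j + 1 ≤ b)
    (x : Euc d) : ‖iteratedFDeriv ℝ j f x‖ₑ ≤ C * wNorm a b p f := by
  have h := hC _ (iteratedFDeriv ℝ j f)
    (hf.iteratedFDeriv_right (by rw [add_comm]; exact_mod_cast h2)) x
  refine h.trans ?_
  gcongr
  refine le_trans (le_of_eq ?_) (wNorm_ge a b p f j h1 h2)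
  congr 1
  apply eLpNorm_congr_norm_ae
  exact Filter.Eventually.of_forall fun y => norm_fderiv_iteratedFDeriv

lemma toReal_bound {E : Type*} [NormedAddCommGroup E] (v : E) (M : ℝ≥0∞) (hM : M ≠ ∞)
    (h : ‖v‖ₑ ≤ M) : ‖v‖ ≤ M.toReal := by
  rw [← toReal_enorm]
  exact ENNReal.toReal_mono hM h

lemma eLpNorm_sum_norm_le {d : ℕ} (a b : ℕ) (p : ℝ) (hp : 1 ≤ p) (f : Euc d → Euc d)
    (hf : ContDiff ℝ b f) :
    eLpNorm (fun x => ∑ j ∈ Finset.Icc a b, ‖iteratedFDeriv ℝ j f x‖) (ENNReal.ofReal p) volume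
      ≤ wNorm a b p f := by
  have h := eLpNorm_sum_le (μ := (volume : Measure (Euc d))) (p := ENNReal.ofReal p)
    (s := Finset.Icc a b)
    (f := fun j x => ‖iteratedFDeriv ℝ j f x‖) (fun j hj => by
      have : j ≤ b := (Finset.mem_Icc.1 hj).2
      exact ((hf.continuous_iteratedFDeriv (by exact_mod_cast this)).norm).aestronglyMeasurable)
      (by simpa using hp)
  simp only [eLpNorm_norm] at h
  refine le_trans (le_of_eq ?_) h
  congr 1
  funext x
  simp

lemma three_pow (a b : ℝ≥0∞) (N : ℕ) : (1 + a + b) ^ N ≤ 3 ^ N * (1 + a ^ N + b ^ N) := by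
  have h : 1 + a + b ≤ 3 * max 1 (max a b) := by
    calc 1 + a + b ≤ max 1 (max a b) + max 1 (max a b) + max 1 (max a b) := by
          gcongr
          · exact le_max_left _ _
          · exact (le_max_left _ _).trans (le_max_right _ _)
          · exact (le_max_right _ _).trans (le_max_right _ _)
      _ = _ := by ring
  refine (pow_le_pow_left' h N).trans ?_
  rw [mul_pow]
  gcongr
  rcases max_choice 1 (max a b) with h | h <;> rw [h]
  · rw [one_pow, add_assoc]; exact le_self_add
  · rcases max_choice a b with h | h <;> rw [h]
    · rw [add_right_comm]; exact le_add_self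
    · exact le_add_self

/-- For `k ∈ ℕ₀` and `p > d` there exist `c = c(k,p,d) > 0` and
`α_k ∈ ℕ₀` such that for all `u ∈ W^{k+2,p}` and all `X ∈ 𝕏^{k+2,p}` preserving
Lebesgue measure (equivalently `det(∇X) = 1`),
`‖∇(u∘X)‖_{k+1,p} ≤ c ‖∇u‖_{k+1,p} (1 + ‖∇X‖_∞^{k+2} + ‖∇²X‖_{k,p}^{α_k})`. -/
theorem composition_sobolev_estimate (d k : ℕ) (hd : 2 ≤ d) (p : ℝ) (hp : (d : ℝ) < p) :
    ∃ c : ℝ≥0, 0 < c ∧ ∃ α : ℕ, ∀ u X : Euc d → Euc d,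
      MemW (k+2) p u → MemX k p X →
      MeasureTheory.MeasurePreserving X volume volume →
      (∀ x, LinearMap.det ((fderiv ℝ X x : Euc d →L[ℝ] Euc d) : Euc d →ₗ[ℝ] Euc d) = 1) →
      wNorm 1 (k+2) p (u ∘ X) ≤
        (c : ℝ≥0∞) * wNorm 1 (k+2) p u *
          (1 + supNorm (fderiv ℝ X) ^ (k+2) + wNorm 2 (k+2) p X ^ α) := by
  have hp1 : 1 ≤ p := by
    have : (2 : ℝ) ≤ d := by exact_mod_cast hd
    linarith
  obtain ⟨C₀, hC₀⟩ := morrey d p hp hp1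
  set C : ℝ≥0 := C₀ + 1 with hCdef
  have hC1 : 1 ≤ C := by simp [hCdef]
  have hC : ∀ (F : Type) [NormedAddCommGroup F] [NormedSpace ℝ F] [CompleteSpace F]
      (f : Euc d → F), ContDiff ℝ 1 f → ∀ x,
      ‖f x‖ₑ ≤ C * (eLpNorm f (ENNReal.ofReal p) volume +
        eLpNorm (fderiv ℝ f) (ENNReal.ofReal p) volume) := by
    intro F _ _ _ f hf x
    refine (hC₀ F f hf x).trans ?_
    gcongr
    simp [hCdef]
  set K : ℝ≥0 := 2 ^ (k + 1) * ((k + 1).factorial : ℝ≥0) with hK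
  have hK0 : 0 < K := by positivity
  refine ⟨(k + 2) * (K * (3 ^ (k + 2) * C ^ (k + 2) + C)), by positivity, k + 2, ?_⟩
  intro u X hu hX hmp _
  obtain ⟨huc, hun⟩ := hu
  obtain ⟨hXc, hXs, hXn⟩ := hX
  have huc' : ContDiff ℝ ((k + 2 : ℕ) : WithTop ℕ∞) u := by exact_mod_cast huc
  have hXc' : ContDiff ℝ ((k + 2 : ℕ) : WithTop ℕ∞) X := by exact_mod_cast hXc
  set A := supNorm (fderiv ℝ X) with hA
  set B := wNorm 2 (k + 2) p X with hB
  set W := wNorm 1 (k + 2) p u with hW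
  have hWt : W ≠ ∞ := by
    refine (lt_of_le_of_lt ?_ hun).ne
    exact Finset.sum_le_sum_of_subset (Finset.Icc_subset_Icc_left zero_le_one)
  have hDt : 1 + A + C * B ≠ ∞ := by
    simp only [ne_eq, ENNReal.add_eq_top, ENNReal.one_ne_top, false_or, not_or]
    exact ⟨hXs.ne, ENNReal.mul_ne_top ENNReal.coe_ne_top hXn.ne⟩
  have hSt : C * W ≠ ∞ := ENNReal.mul_ne_top ENNReal.coe_ne_top hWt
  set D := (1 + A + C * B).toReal with hD
  set S := (C * W).toReal with hS
  have hDe : ENNReal.ofReal D = 1 + A + C * B := ENNReal.ofReal_toReal hDt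
  have hSe : ENNReal.ofReal S = C * W := ENNReal.ofReal_toReal hSt
  have hD1 : 1 ≤ D := by
    rw [hD, ← ENNReal.toReal_one]
    exact ENNReal.toReal_mono hDt (by rw [add_assoc]; exact le_self_add)
  have hDj : ∀ j, 1 ≤ j → j ≤ k + 1 → ∀ x, ‖iteratedFDeriv ℝ j X x‖ ≤ D := by
    intro j h1 h2 x
    by_cases hj : j = 1
    · subst hj
      rw [norm_iteratedFDeriv_one]
      refine toReal_bound _ _ hDt ?_
      have : ‖fderiv ℝ X x‖ₑ ≤ A := le_iSup (fun x => (‖fderiv ℝ X x‖₊ : ℝ≥0∞)) x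
      refine this.trans ?_
      rw [add_right_comm]; exact le_add_self
    · refine toReal_bound _ _ hDt ?_
      exact (sup_iter p C hC 2 (k + 2) X hXc' j (by omega) (by omega) x).trans le_add_self
  have hSu : ∀ y, ‖fderiv ℝ u y‖ ≤ S := by
    intro y
    rw [← norm_iteratedFDeriv_one]
    exact toReal_bound _ _ hSt (sup_iter p C hC 1 (k + 2) u huc' 1 le_rfl (by omega) y)
  have hS0 : 0 ≤ S := ENNReal.toReal_nonneg
  have hone : (1 : ℝ≥0∞) ≤ ENNReal.ofReal p := by simpa using hp1
  set G : Euc d → ℝ := fun y => ∑ j ∈ Finset.Icc 1 (k + 2), ‖iteratedFDeriv ℝ j u y‖ with hG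
  set H : Euc d → ℝ := fun y => ∑ j ∈ Finset.Icc 2 (k + 2), ‖iteratedFDeriv ℝ j X y‖ with hH
  have hGc : Continuous G := continuous_finsetSum _ fun j hj =>
    (huc'.continuous_iteratedFDeriv (by exact_mod_cast (Finset.mem_Icc.1 hj).2)).norm
  have hHc : Continuous H := continuous_finsetSum _ fun j hj =>
    (hXc'.continuous_iteratedFDeriv (by exact_mod_cast (Finset.mem_Icc.1 hj).2)).norm
  have hbound : ∀ j ∈ Finset.Icc 1 (k + 2),
      eLpNorm (iteratedFDeriv ℝ j (u ∘ X)) (ENNReal.ofReal p) volume ≤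
        K * ((1 + A + C * B) ^ (k + 2) * W + C * W * B) := by
    intro j hj
    obtain ⟨hj1, hj2⟩ := Finset.mem_Icc.1 hj
    obtain ⟨n, rfl⟩ : ∃ n, j = n + 1 := ⟨j - 1, by omega⟩
    have hn : n ≤ k + 1 := by omega
    have h1 : ∀ x, ‖iteratedFDeriv ℝ (n + 1) (u ∘ X) x‖ ≤
        ((K : ℝ) • (D ^ (k + 2) • (G ∘ X) + S • H)) x := by
      intro x
      refine (pointwise_comp k n hn u X huc hXc D S hD1 hS0 hDj hSu x).trans ?_
      have hg : 0 ≤ G (X x) := Finset.sum_nonneg fun _ _ => norm_nonneg _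
      have hh : 0 ≤ H x := Finset.sum_nonneg fun _ _ => norm_nonneg _
      have hD0 : 0 ≤ D := by linarith
      have hf : (n.factorial : ℝ) ≤ (k + 1).factorial := by
        exact_mod_cast Nat.factorial_le hn
      have h2 : (2 : ℝ) ^ n ≤ 2 ^ (k + 1) := pow_le_pow_right₀ one_le_two hn
      simp only [Pi.smul_apply, Pi.add_apply, smul_eq_mul, Function.comp, hK]
      push_cast
      change _ * (D ^ (k + 2) * G (X x) + S * H x) ≤ _
      have : 0 ≤ D ^ (k + 2) * G (X x) + S * H x := by positivity
      gcongr
    refine (eLpNorm_mono_real h1).trans ?_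
    rw [eLpNorm_const_smul]
    have hKe : ‖(K : ℝ)‖ₑ = K := by simp
    rw [hKe]
    gcongr
    refine (eLpNorm_add_le ?_ ?_ hone).trans ?_
    · exact ((hGc.comp hXc.continuous).const_smul _).aestronglyMeasurable
    · exact (hHc.const_smul _).aestronglyMeasurable
    rw [eLpNorm_const_smul, eLpNorm_const_smul,
      eLpNorm_comp_measurePreserving hGc.aestronglyMeasurable hmp]
    have e1 : ‖D ^ (k + 2)‖ₑ = (1 + A + C * B) ^ (k + 2) := by
      rw [enorm_pow, Real.enorm_eq_ofReal (by linarith), hDe]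
    have e2 : ‖S‖ₑ = C * W := by rw [Real.enorm_eq_ofReal hS0, hSe]
    rw [e1, e2]
    gcongr
    · exact eLpNorm_sum_norm_le 1 (k + 2) p hp1 u huc'
    · exact eLpNorm_sum_norm_le 2 (k + 2) p hp1 X hXc'
  have hC1e : (1 : ℝ≥0∞) ≤ (C : ℝ≥0∞) ^ (k + 2) := one_le_pow₀ (by exact_mod_cast hC1)
  have hfin1 : (1 + A + C * B) ^ (k + 2) ≤
      3 ^ (k + 2) * C ^ (k + 2) * (1 + A ^ (k + 2) + B ^ (k + 2)) := by
    refine (three_pow _ _ _).trans ?_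
    rw [mul_pow, mul_assoc]
    gcongr
    calc 1 + A ^ (k + 2) + (C : ℝ≥0∞) ^ (k + 2) * B ^ (k + 2)
        = 1 * (1 + A ^ (k + 2)) + (C : ℝ≥0∞) ^ (k + 2) * B ^ (k + 2) := by rw [one_mul]
      _ ≤ (C : ℝ≥0∞) ^ (k + 2) * (1 + A ^ (k + 2)) + (C : ℝ≥0∞) ^ (k + 2) * B ^ (k + 2) := by
          gcongr
      _ = _ := by ring
  have hfin2 : B ≤ 1 + A ^ (k + 2) + B ^ (k + 2) := by
    rcases le_total B 1 with h | h
    · refine h.trans ?_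
      rw [add_assoc]; exact le_self_add
    · exact (le_self_pow₀ h (by omega)).trans le_add_self
  calc wNorm 1 (k + 2) p (u ∘ X)
      ≤ ∑ j ∈ Finset.Icc 1 (k + 2), (K * ((1 + A + C * B) ^ (k + 2) * W + C * W * B) : ℝ≥0∞) :=
        Finset.sum_le_sum hbound
    _ = (k + 2) * (K * ((1 + A + C * B) ^ (k + 2) * W + C * W * B)) := by
        rw [Finset.sum_const, Nat.card_Icc, nsmul_eq_mul]
        simp
    _ ≤ (k + 2) * (K * (3 ^ (k + 2) * C ^ (k + 2) * (1 + A ^ (k + 2) + B ^ (k + 2)) * W +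
          C * W * (1 + A ^ (k + 2) + B ^ (k + 2)))) := by gcongr
    _ = _ := by
        push_cast
        ring
end
end

section
/- For p > d there exists a constant c = c(p,d) > 0 such that for all u ∈ W^{2,p}(ℝ^d;ℝ^d) and all X, X̃ ∈ 𝕏^{2,p} with X − X̃ ∈ L^p(ℝ^d;ℝ^d), one has ‖u∘X − u∘X̃‖_p ≤ c ‖∇u‖_{1,p} · ‖X − X̃‖_p. -/
open MeasureTheory ProbabilityTheory Filter Set
open scoped ENNReal NNReal Topology

noncomputable section

/-- Translation and scaling of the `L^p` norm. -/
lemma cde_scale {d : ℕ} {F : Type*} [NormedAddCommGroup F] (P : ℝ≥0∞)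
    (f : Euc d → F) (hf : Continuous f) (x : Euc d) {t : ℝ} (ht : t ≠ 0) :
    eLpNorm (fun z => f (x + t • z)) P volume
      = (ENNReal.ofReal |(t ^ d)⁻¹|) ^ (1 / P).toReal * eLpNorm f P volume := by
  have h1 : eLpNorm (fun y => f (x + y)) P volume = eLpNorm f P volume :=
    eLpNorm_comp_measurePreserving (hf.aestronglyMeasurable)
      (measurePreserving_add_left volume x)
  have hm := Measure.map_addHaar_smul (volume : Measure (Euc d)) ht
  have hc : Continuous fun y => f (x + y) := by fun_prop
  have h2 := eLpNorm_map_measure (p := P) (μ := (volume : Measure (Euc d)))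
    (f := fun z : Euc d => t • z) (g := fun y => f (x + y))
    hc.aestronglyMeasurable (by fun_prop)
  rw [hm, eLpNorm_smul_measure_of_ne_zero, h1, smul_eq_mul] at h2
  · simpa [Function.comp_def] using h2.symm
  · simp [ht]

/-- Hoelder on the unit ball. -/
lemma cde_holder {d : ℕ} {F : Type*} [NormedAddCommGroup F] {P : ℝ≥0∞} (hP : 1 ≤ P)
    (f : Euc d → F) (hf : Continuous f) :
    ∫⁻ z in Metric.ball (0 : Euc d) 1, ‖f z‖ₑ
      ≤ eLpNorm f P volume * volume (Metric.ball (0 : Euc d) 1) ^ (1 - 1 / P.toReal) := by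
  rw [← eLpNorm_one_eq_lintegral_enorm]
  refine (eLpNorm_le_eLpNorm_mul_rpow_measure_univ hP hf.aestronglyMeasurable).trans ?_
  rw [Measure.restrict_apply_univ]
  simp only [ENNReal.toReal_one, div_one]
  gcongr
  exact Measure.restrict_le_self

lemma cde_ftc {d : ℕ} {F : Type*} [NormedAddCommGroup F] [NormedSpace ℝ F] [CompleteSpace F]
    (g : Euc d → F) (hg : ContDiff ℝ 1 g) (x z : Euc d) (hz : z ∈ Metric.ball (0 : Euc d) 1) :
    ‖g x‖ₑ ≤ ‖g (x + z)‖ₑ + ∫⁻ t in Ioc (0 : ℝ) 1, ‖fderiv ℝ g (x + t • z)‖ₑ := by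
  have hD : Continuous (fderiv ℝ g) := hg.continuous_fderiv (by norm_num)
  have hc : Continuous fun t : ℝ => fderiv ℝ g (x + t • z) z := by fun_prop
  have hft : ∫ t in (0 : ℝ)..1, fderiv ℝ g (x + t • z) z = g (x + (1 : ℝ) • z) - g (x + (0 : ℝ) • z) := by
    refine intervalIntegral.integral_eq_sub_of_hasDerivAt (f := fun t : ℝ => g (x + t • z)) ?_
      (hc.intervalIntegrable _ _)
    intro t _
    have h1 : HasFDerivAt g (fderiv ℝ g (x + t • z)) (x + t • z) :=
      (hg.differentiable (by norm_num) _).hasFDerivAt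
    have h2 : HasDerivAt (fun t : ℝ => x + t • z) z t := by
      simpa using ((hasDerivAt_id t).smul_const z).const_add x
    exact h1.comp_hasDerivAt t h2
  rw [intervalIntegral.integral_of_le zero_le_one] at hft
  simp only [one_smul, zero_smul, add_zero] at hft
  have : g x = g (x + z) - ∫ t in Ioc (0 : ℝ) 1, fderiv ℝ g (x + t • z) z := by
    rw [hft]; abel
  calc ‖g x‖ₑ = ‖g (x + z) - ∫ t in Ioc (0 : ℝ) 1, fderiv ℝ g (x + t • z) z‖ₑ := by rw [← this]
    _ ≤ ‖g (x + z)‖ₑ + ‖∫ t in Ioc (0 : ℝ) 1, fderiv ℝ g (x + t • z) z‖ₑ := enorm_sub_le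
    _ ≤ _ := by
      gcongr
      refine (enorm_integral_le_lintegral_enorm _).trans ?_
      refine lintegral_mono fun t => ?_
      refine enorm_le_iff_norm_le.2 ?_
      have hz' : ‖z‖ ≤ 1 := by simpa using (mem_ball_zero_iff.1 hz).le
      calc _ ≤ ‖fderiv ℝ g (x + t • z)‖ * ‖z‖ := ContinuousLinearMap.le_opNorm _ _
        _ ≤ ‖fderiv ℝ g (x + t • z)‖ * 1 := by gcongr
        _ = _ := mul_one _

lemma cde_T (d : ℕ) (p : ℝ) (hp0 : 0 < p) (hp : (d : ℝ) < p) :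
    ∫⁻ t in Ioc (0 : ℝ) 1, (ENNReal.ofReal |(t ^ d)⁻¹|) ^ (1 / ENNReal.ofReal p).toReal < ∞ := by
  have hr : -1 < -(d / p : ℝ) := by
    have : (d : ℝ) / p < 1 := (div_lt_one hp0).2 hp
    linarith
  have hi := (intervalIntegral.intervalIntegrable_rpow' (a := 0) (b := 1) hr)
  rw [intervalIntegrable_iff_integrableOn_Ioc_of_le zero_le_one] at hi
  refine lt_of_le_of_lt (le_of_eq ?_) hi.2
  refine setLIntegral_congr_fun measurableSet_Ioc fun t ht => ?_
  have ht0 : 0 < t := ht.1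
  have he : (1 / ENNReal.ofReal p).toReal = 1 / p := by
    simp [ENNReal.toReal_inv, ENNReal.toReal_ofReal hp0.le]
  have hpos : 0 < (t ^ d)⁻¹ := by positivity
  simp only [he]
  rw [abs_of_pos hpos, ENNReal.ofReal_rpow_of_pos hpos, Real.enorm_of_nonneg (by positivity)]
  congr 1
  rw [← Real.rpow_natCast, ← Real.rpow_neg ht0.le, ← Real.rpow_mul ht0.le]
  congr 1
  ring

/-- Morrey's sup bound for `p > d`. -/
lemma cde_morrey (d : ℕ) (p : ℝ) (hp1 : 1 ≤ p) (hp : (d : ℝ) < p) :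
    ∃ c : ℝ≥0, 0 < c ∧ ∀ g : Euc d → (Euc d →L[ℝ] Euc d), ContDiff ℝ 1 g → ∀ x,
      ‖g x‖ₑ ≤ c * (eLpNorm g (ENNReal.ofReal p) volume
        + eLpNorm (fderiv ℝ g) (ENNReal.ofReal p) volume) := by
  set P := ENNReal.ofReal p with hPdef
  have hP1 : 1 ≤ P := by simpa [hPdef] using ENNReal.ofReal_le_ofReal hp1
  set V := volume (Metric.ball (0 : Euc d) 1) with hV
  have hV0 : V ≠ 0 := (Metric.measure_ball_pos _ _ one_pos).ne'
  have hVt : V ≠ ∞ := measure_ball_lt_top.ne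
  set A := V ^ (1 - 1 / P.toReal) with hA
  have hAt : A ≠ ∞ := by
    refine ENNReal.rpow_ne_top_of_ne_zero hV0 hVt
  set T := ∫⁻ t in Ioc (0 : ℝ) 1, (ENNReal.ofReal |(t ^ d)⁻¹|) ^ (1 / P).toReal with hT
  have hTt : T ≠ ∞ := (cde_T d p (by linarith) hp).ne
  set C := V⁻¹ * (A * (1 + T)) with hC
  have hCt : C ≠ ∞ := by
    refine ENNReal.mul_ne_top (ENNReal.inv_ne_top.2 hV0) (ENNReal.mul_ne_top hAt ?_)
    simp [hTt]
  refine ⟨C.toNNReal + 1, by positivity, fun g hg x => ?_⟩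
  have hD : Continuous (fderiv ℝ g) := hg.continuous_fderiv (by norm_num)
  have hgc : Continuous g := hg.continuous
  set G := eLpNorm g P volume with hG
  set H := eLpNorm (fderiv ℝ g) P volume with hH
  have key : V * ‖g x‖ₑ ≤ G * A + T * (H * A) := by
    calc V * ‖g x‖ₑ = ∫⁻ z in Metric.ball (0 : Euc d) 1, ‖g x‖ₑ := by
          rw [setLIntegral_const, mul_comm]
      _ ≤ ∫⁻ z in Metric.ball (0 : Euc d) 1, (‖g (x + z)‖ₑ
            + ∫⁻ t in Ioc (0 : ℝ) 1, ‖fderiv ℝ g (x + t • z)‖ₑ) :=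
          setLIntegral_mono' measurableSet_ball fun z hz => cde_ftc g hg x z hz
      _ = (∫⁻ z in Metric.ball (0 : Euc d) 1, ‖g (x + z)‖ₑ)
            + ∫⁻ z in Metric.ball (0 : Euc d) 1,
                ∫⁻ t in Ioc (0 : ℝ) 1, ‖fderiv ℝ g (x + t • z)‖ₑ := by
          refine lintegral_add_left ?_ _
          exact (by fun_prop : Continuous fun z => ‖g (x + z)‖ₑ).measurable
      _ = (∫⁻ z in Metric.ball (0 : Euc d) 1, ‖g (x + z)‖ₑ)
            + ∫⁻ t in Ioc (0 : ℝ) 1, ∫⁻ z in Metric.ball (0 : Euc d) 1,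
                ‖fderiv ℝ g (x + t • z)‖ₑ := by
          congr 1
          refine lintegral_lintegral_swap ?_
          exact (by fun_prop : Continuous fun q : Euc d × ℝ =>
            ‖fderiv ℝ g (x + q.2 • q.1)‖ₑ).measurable.aemeasurable
      _ ≤ G * A + ∫⁻ t in Ioc (0 : ℝ) 1,
            (ENNReal.ofReal |(t ^ d)⁻¹|) ^ (1 / P).toReal * (H * A) := by
          refine add_le_add ?_ ?_
          · refine (cde_holder hP1 (fun z => g (x + z)) (by fun_prop)).trans (le_of_eq ?_)
            have := cde_scale P g hgc x (one_ne_zero)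
            simp only [one_smul] at this
            rw [this]; simp [hG, hA, hV]
          · refine setLIntegral_mono' measurableSet_Ioc fun t ht => ?_
            refine (cde_holder hP1 (fun z => fderiv ℝ g (x + t • z)) (by fun_prop)).trans
              (le_of_eq ?_)
            rw [cde_scale P _ hD x ht.1.ne', mul_assoc]
      _ = G * A + T * (H * A) := by
          rw [lintegral_mul_const _ (by fun_prop)]
  have h2 : ‖g x‖ₑ ≤ V⁻¹ * (G * A + T * (H * A)) := by
    calc ‖g x‖ₑ = V⁻¹ * (V * ‖g x‖ₑ) := by
          rw [← mul_assoc, ENNReal.inv_mul_cancel hV0 hVt, one_mul]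
      _ ≤ _ := by gcongr
  calc ‖g x‖ₑ ≤ V⁻¹ * (G * A + T * (H * A)) := h2
    _ ≤ V⁻¹ * ((1 + T) * (G * A) + (1 + T) * (H * A)) := by
      refine mul_le_mul_right (add_le_add ?_ ?_) _
      · exact le_mul_of_one_le_left zero_le le_self_add
      · exact mul_le_mul_left le_add_self _
    _ = C * (G + H) := by rw [hC]; ring
    _ ≤ _ := by
      gcongr
      rw [ENNReal.coe_add, ENNReal.coe_toNNReal hCt]
      exact le_self_add

/-- For `p > d` there is `c = c(p,d) > 0` such that for all
`u ∈ W^{2,p}` and `X, X̃ ∈ 𝕏^{2,p}` with `X - X̃ ∈ L^p`,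
`‖u∘X - u∘X̃‖_p ≤ c ‖∇u‖_{1,p} ‖X - X̃‖_p`. -/
theorem composition_difference_estimate (d : ℕ) (hd : 2 ≤ d) (p : ℝ) (hp : (d : ℝ) < p) :
    ∃ c : ℝ≥0, 0 < c ∧ ∀ u X X' : Euc d → Euc d,
      MemW 2 p u → MemX 0 p X → MemX 0 p X' →
      eLpNorm (fun x => X x - X' x) (ENNReal.ofReal p) volume < ∞ →
      eLpNorm (fun x => u (X x) - u (X' x)) (ENNReal.ofReal p) volume ≤
        (c : ℝ≥0∞) * wNorm 1 2 p u * eLpNorm (fun x => X x - X' x) (ENNReal.ofReal p) volume := by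
  have hd' : (2 : ℝ) ≤ d := by exact_mod_cast hd
  obtain ⟨c, hc, hM⟩ := cde_morrey d p (by linarith) hp
  refine ⟨c, hc, fun u X X' hu _ _ _ => ?_⟩
  have hw : wNorm 1 2 p u ≠ ∞ := by
    refine (lt_of_le_of_lt ?_ hu.2).ne
    exact Finset.sum_le_sum_of_subset (Finset.Icc_subset_Icc (by norm_num) le_rfl)
  have hwe : wNorm 1 2 p u = eLpNorm (fderiv ℝ u) (ENNReal.ofReal p) volume
      + eLpNorm (fderiv ℝ (fderiv ℝ u)) (ENNReal.ofReal p) volume := by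
    have h12 : Finset.Icc 1 2 = {1, 2} := by decide
    rw [wNorm, h12, Finset.sum_pair (by norm_num)]
    have e1 : ∀ x, ‖iteratedFDeriv ℝ 1 u x‖ = ‖fderiv ℝ u x‖ :=
      fun x => norm_iteratedFDeriv_one u
    have e2 : ∀ x, ‖iteratedFDeriv ℝ 2 u x‖ = ‖fderiv ℝ (fderiv ℝ u) x‖ := fun x =>
      (norm_iteratedFDeriv_fderiv (𝕜 := ℝ) (f := u) (x := x) (n := 1)).symm.trans
        (norm_iteratedFDeriv_one (fderiv ℝ u))
    rw [eLpNorm_congr_norm_ae (f := iteratedFDeriv ℝ 1 u) (g := fderiv ℝ u)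
        (Eventually.of_forall e1),
      eLpNorm_congr_norm_ae (f := iteratedFDeriv ℝ 2 u) (g := fderiv ℝ (fderiv ℝ u))
        (Eventually.of_forall e2)]
  have hu2 : ContDiff ℝ 2 u := hu.1
  have hg : ContDiff ℝ 1 (fderiv ℝ u) := hu2.fderiv_right (by norm_num)
  have hKt : (c : ℝ≥0∞) * wNorm 1 2 p u ≠ ∞ := ENNReal.mul_ne_top ENNReal.coe_ne_top hw
  have hb : ∀ x, ‖fderiv ℝ u x‖₊ ≤ ((c : ℝ≥0∞) * wNorm 1 2 p u).toNNReal := fun x => by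
    refine ENNReal.coe_le_coe.1 ?_
    rw [ENNReal.coe_toNNReal hKt, hwe]
    exact hM _ hg x
  have hL := lipschitzWith_of_nnnorm_fderiv_le (𝕜 := ℝ) (hu2.differentiable (by norm_num)) hb
  have := eLpNorm_le_nnreal_smul_eLpNorm_of_ae_le_mul (μ := (volume : Measure (Euc d)))
    (f := fun x => u (X x) - u (X' x)) (g := fun x => X x - X' x)
    (c := ((c : ℝ≥0∞) * wNorm 1 2 p u).toNNReal)
    (Eventually.of_forall fun x => by
      simpa [nndist_eq_nnnorm] using hL.nndist_le (X x) (X' x)) (ENNReal.ofReal p)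
  rwa [ENNReal.smul_def, smul_eq_mul, ENNReal.coe_toNNReal hKt] at this
end
end

section
/- Beale–Kato–Majda type logarithmic estimate: for p > d, let u ∈ W^{2,p}(ℝ^d;ℝ^d) be a divergence-free vector field and ω := curl u. Then for some constant c = c(p,d): ‖∇u‖_∞ ≤ c (1 + log⁺‖ω‖_{1,p}) (1 + ‖ω‖_∞), where log⁺x := max{log x, 0} for x > 0. -/
open MeasureTheory ProbabilityTheory Filter Set
open scoped ENNReal NNReal Topology

noncomputable section

/-- The vorticity (curl) of a vector field on `ℝ^d`, as the antisymmetric part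
`(curl u)_{ij} = ∂_i u^j - ∂_j u^i` of the gradient. -/
def curlMat {d : ℕ} (u : Euc d → Euc d) (x : Euc d) : Fin d → Fin d → ℝ :=
  fun i j => fderiv ℝ u x (ee i) j - fderiv ℝ u x (ee j) i


lemma ftc_compare (F F' B B' : ℝ → ℝ) (a b : ℝ) (hab : a ≤ b)
    (hF : ∀ r, HasDerivAt F (F' r) r)
    (hB : ∀ r ∈ Icc a b, HasDerivAt B (B' r) r)
    (h : ∀ r ∈ Icc a b, |F' r| ≤ B' r) : |F b - F a| ≤ B b - B a := by
  have := image_norm_le_of_norm_deriv_right_le_deriv_boundary' (f := fun r => F r - F a)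
    (f' := F') (a := a) (b := b) (B := fun r => B r - B a) (B' := B')
    (by
      intro x _
      exact ((hF x).continuousAt.sub continuousAt_const).continuousWithinAt)
    (fun x _ => ((hF x).sub_const _).hasDerivWithinAt)
    (by simp)
    (by
      intro x hx
      exact ((hB x hx).continuousAt.sub continuousAt_const).continuousWithinAt)
    (fun x hx => ((hB x (Ico_subset_Icc_self hx)).sub_const _).hasDerivWithinAt)
    (fun x hx => h x (Ico_subset_Icc_self hx))
  exact this (right_mem_Icc.2 hab)

lemma core_bound (F F' : ℝ → ℝ) (A W N b : ℝ) (hA : 0 ≤ A) (hN : 1 ≤ N)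
    (hb0 : 0 < b) (hb1 : b < 1) (hF : ∀ r, HasDerivAt F (F' r) r)
    (h1 : ∀ r, 0 < r → |F' r| ≤ A * N * r ^ (-b))
    (h2 : ∀ r, 0 < r → |F' r| ≤ A * W * r⁻¹)
    (h3 : ∀ r, 0 < r → |F' r| ≤ A * N * r ^ (-b - 1))
    (hlim : Tendsto F atTop (𝓝 0)) :
    |F 0| ≤ A * (1 / (1 - b) + W * ((1 / (1 - b) + 1 / b) * Real.log N) + 1 / b) := by
  have hN0 : 0 < N := by linarith
  have ha0 : 0 < 1 - b := by linarith
  set ε := N ^ (-(1 / (1 - b))) with hε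
  set R := N ^ (1 / b) with hR
  have hε0 : 0 < ε := Real.rpow_pos_of_pos hN0 _
  have hR0 : 0 < R := Real.rpow_pos_of_pos hN0 _
  have hεR : ε ≤ R := Real.rpow_le_rpow_of_exponent_le hN (by
    have : 0 < 1 / (1-b) := by positivity
    have : 0 < 1 / b := by positivity
    linarith)
  have e1 : N * ε ^ (1 - b) = 1 := by
    rw [hε, ← Real.rpow_mul hN0.le]
    have : -(1 / (1 - b)) * (1 - b) = -1 := by field_simp
    rw [this, Real.rpow_neg_one, mul_inv_cancel₀ hN0.ne']
  have e2 : N * R ^ (-b) = 1 := by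
    rw [hR, ← Real.rpow_mul hN0.le]
    have : (1 / b) * (-b) = -1 := by field_simp
    rw [this, Real.rpow_neg_one, mul_inv_cancel₀ hN0.ne']
  have p1 : ∀ δ ∈ Ioc 0 ε, |F ε - F δ| ≤ A * (1 / (1 - b)) := by
    intro δ hδ
    have := ftc_compare F F' (fun r => A * N * (r ^ (1 - b) / (1 - b)))
      (fun r => A * N * r ^ (-b)) δ ε hδ.2 hF (by
        intro r hr
        have hr0 : 0 < r := lt_of_lt_of_le hδ.1 hr.1
        have := ((Real.hasDerivAt_rpow_const (x := r) (p := 1 - b)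
          (Or.inl hr0.ne')).div_const (1 - b)).const_mul (A * N)
        refine this.congr_deriv ?_
        rw [show (1 - b - 1) = -b by ring]
        field_simp) (fun r hr => h1 r (lt_of_lt_of_le hδ.1 hr.1))
    refine this.trans ?_
    have hδp : 0 ≤ A * N * (δ ^ (1 - b) / (1 - b)) := by
      have := Real.rpow_nonneg hδ.1.le (1 - b)
      positivity
    have : A * N * (ε ^ (1 - b) / (1 - b)) = A * (N * ε ^ (1-b)) / (1 - b) := by ring
    rw [this, e1]
    have : A * 1 / (1 - b) = A * (1 / (1 - b)) := by ring
    linarith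
  have p1' : |F ε - F 0| ≤ A * (1 / (1 - b)) := by
    have ht : Tendsto (fun δ => |F ε - F δ|) (𝓝[>] 0) (𝓝 |F ε - F 0|) :=
      (((tendsto_const_nhds.sub (hF 0).continuousAt.tendsto).abs).mono_left nhdsWithin_le_nhds)
    exact le_of_tendsto ht (by
      filter_upwards [Ioc_mem_nhdsGT hε0] with δ hδ using p1 δ hδ)
  have p2 : |F R - F ε| ≤ A * (W * ((1 / (1 - b) + 1 / b) * Real.log N)) := by
    have := ftc_compare F F' (fun r => A * W * Real.log r)
      (fun r => A * W * r⁻¹) ε R hεR hF (by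
        intro r hr
        have hr0 : 0 < r := lt_of_lt_of_le hε0 hr.1
        exact (Real.hasDerivAt_log hr0.ne').const_mul (A * W)) (fun r hr => h2 r (lt_of_lt_of_le hε0 hr.1))
    refine this.trans (le_of_eq ?_)
    rw [hR, hε, Real.log_rpow hN0, Real.log_rpow hN0]
    ring
  have p3 : ∀ S, R ≤ S → |F S - F R| ≤ A * (1 / b) := by
    intro S hS
    have := ftc_compare F F' (fun r => A * N * (-(r ^ (-b) / b)))
      (fun r => A * N * r ^ (-b - 1)) R S hS hF (by
        intro r hr
        have hr0 : 0 < r := lt_of_lt_of_le hR0 hr.1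
        have := (((Real.hasDerivAt_rpow_const (x := r) (p := -b)
          (Or.inl hr0.ne')).div_const b).neg).const_mul (A * N)
        refine this.congr_deriv ?_
        field_simp) (fun r hr => h3 r (lt_of_lt_of_le hR0 hr.1))
    refine this.trans ?_
    have hδp : 0 ≤ A * N * (S ^ (-b) / b) := by
      have := Real.rpow_nonneg (hR0.le.trans hS) (-b)
      positivity
    have : A * N * (R ^ (-b) / b) = A * (N * R ^ (-b)) / b := by ring
    rw [mul_neg, mul_neg, this, e2]
    have : A * 1 / b = A * (1 / b) := by ring
    linarith
  have p3' : |0 - F R| ≤ A * (1 / b) := by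
    have ht : Tendsto (fun S => |F S - F R|) atTop (𝓝 |0 - F R|) :=
      (hlim.sub tendsto_const_nhds).abs
    exact le_of_tendsto ht (by
      filter_upwards [eventually_ge_atTop R] with S hS using p3 S hS)
  have : F 0 = -(F ε - F 0) - (F R - F ε) - (0 - F R) := by ring
  rw [abs_le] at *
  constructor <;> linarith [p1'.1, p1'.2, p2.1, p2.2, p3'.1, p3'.2]

def phi {d : ℕ} (z : Euc d) : ℝ := Real.smoothTransition (1 - ‖z‖ ^ 2)

def gg {d : ℕ} (i : Fin d) (z : Euc d) : ℝ := z i * phi z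

lemma phi_contDiff {d : ℕ} : ContDiff ℝ 1 (phi (d := d)) :=
  (Real.smoothTransition.contDiff (n := 1)).comp (contDiff_const.sub (contDiff_norm_sq ℝ))

lemma coord_contDiff {d : ℕ} (i : Fin d) : ContDiff ℝ 1 (fun z : Euc d => z i) :=
  (EuclideanSpace.proj (𝕜 := ℝ) i).contDiff

lemma gg_contDiff {d : ℕ} (i : Fin d) : ContDiff ℝ 1 (gg i) :=
  (coord_contDiff i).mul phi_contDiff

lemma phi_zero_of {d : ℕ} (z : Euc d) (hz : z ∉ Metric.closedBall (0 : Euc d) 1) : phi z = 0 := by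
  apply Real.smoothTransition.zero_of_nonpos
  have : 1 < ‖z‖ := by simpa using hz
  nlinarith

lemma gg_zero_of {d : ℕ} (i : Fin d) (z : Euc d) (hz : z ∉ Metric.closedBall (0 : Euc d) 1) :
    gg i z = 0 := by
  simp [gg, phi_zero_of z hz]

lemma phi_compact {d : ℕ} : HasCompactSupport (phi (d := d)) :=
  HasCompactSupport.intro (isCompact_closedBall 0 1) phi_zero_of

lemma gg_compact {d : ℕ} (i : Fin d) : HasCompactSupport (gg i) :=
  HasCompactSupport.intro (isCompact_closedBall 0 1) (gg_zero_of i)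

lemma dgg_zero_of {d : ℕ} (i : Fin d) (e z : Euc d) (hz : z ∉ Metric.closedBall (0 : Euc d) 1) :
    fderiv ℝ (gg i) z e = 0 := by
  have h : gg i =ᶠ[𝓝 z] fun _ => 0 := by
    filter_upwards [Metric.isClosed_closedBall.isOpen_compl.mem_nhds hz] with y hy
    exact gg_zero_of i y hy
  rw [h.fderiv_eq]
  simp

lemma phi_integral_pos {d : ℕ} : 0 < ∫ z : Euc d, phi z :=
  phi_contDiff.continuous.integral_pos_of_hasCompactSupport_nonneg_nonzero (x := 0) phi_compact
    (fun z => Real.smoothTransition.nonneg _) (by simp [phi])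

lemma gg_symm {d : ℕ} (i j : Fin d) (z : Euc d) :
    fderiv ℝ (gg i) z (ee j) = fderiv ℝ (gg j) z (ee i) := by
  obtain ⟨T, hT⟩ : ∃ T : Euc d →L[ℝ] ℝ, T = -((2 : ℕ) • (innerSL ℝ z : Euc d →L[ℝ] ℝ)) := ⟨_, rfl⟩
  have hphi : HasFDerivAt (phi (d := d))
      (deriv Real.smoothTransition (1 - ‖z‖ ^ 2) • T) z := by
    have h1 : HasFDerivAt (fun z : Euc d => 1 - ‖z‖ ^ 2) T z := hT ▸
      ((hasStrictFDerivAt_norm_sq z).hasFDerivAt).const_sub 1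
    have h2 : HasDerivAt Real.smoothTransition (deriv Real.smoothTransition (1 - ‖z‖ ^ 2))
      (1 - ‖z‖ ^ 2) := ((Real.smoothTransition.contDiff (n := 1)).differentiable
        (by norm_num) _).hasDerivAt
    exact h2.comp_hasFDerivAt z h1
  have hg : ∀ i : Fin d, HasFDerivAt (gg i) _ z := fun i =>
    ((EuclideanSpace.proj (𝕜 := ℝ) i).hasFDerivAt (x := z)).mul hphi
  rw [(hg i).fderiv, (hg j).fderiv, hT]
  by_cases h : i = j
  · subst h; rfl
  · simp [ee, h, Ne.symm h, EuclideanSpace.inner_single_right]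
    ring

lemma affine_contDiff {d : ℕ} (x : Euc d) (r : ℝ) : ContDiff ℝ 1 (fun z : Euc d => x + r • z) := by
  fun_prop

lemma fderiv_affine {d : ℕ} {w : Euc d → ℝ} (hw : ContDiff ℝ 1 w) (x : Euc d) (r : ℝ) (z e : Euc d) :
    fderiv ℝ (fun z => w (x + r • z)) z e = r * fderiv ℝ w (x + r • z) e := by
  have h1 : HasFDerivAt (fun z : Euc d => x + r • z) (r • ContinuousLinearMap.id ℝ (Euc d)) z :=
    ((hasFDerivAt_id z).const_smul r).const_add x
  have h2 := ((hw.differentiable (by norm_num)) (x + r • z)).hasFDerivAt.comp z h1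
  rw [show (fun z => w (x + r • z)) = w ∘ (fun z => x + r • z) from rfl, h2.fderiv]
  simp

lemma ibp {d : ℕ} {w g : Euc d → ℝ} (hw : ContDiff ℝ 1 w) (hg : ContDiff ℝ 1 g)
    (hgc : HasCompactSupport g) (x : Euc d) {r : ℝ} (hr : r ≠ 0) (e : Euc d) :
    ∫ z, fderiv ℝ w (x + r • z) e * g z = -(r⁻¹ * ∫ z, w (x + r • z) * fderiv ℝ g z e) := by
  have hwa : ContDiff ℝ 1 (fun z => w (x + r • z)) := hw.comp (affine_contDiff x r)
  have hdw : Continuous (fun z => fderiv ℝ (fun z => w (x + r • z)) z e) :=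
    (hwa.continuous_fderiv (by norm_num)).clm_apply continuous_const
  have hdg : Continuous (fun z => fderiv ℝ g z e) :=
    (hg.continuous_fderiv (by norm_num)).clm_apply continuous_const
  have hdgc : HasCompactSupport (fun z => fderiv ℝ g z e) := hgc.fderiv_apply ℝ e
  have := integral_mul_fderiv_eq_neg_fderiv_mul_of_integrable (μ := volume)
    (f := fun z => w (x + r • z)) (g := g) (v := e)
    ((hdw.mul hg.continuous).integrable_of_hasCompactSupport hgc.mul_left)
    ((hwa.continuous.mul hdg).integrable_of_hasCompactSupport hdgc.mul_left)
    ((hwa.continuous.mul hg.continuous).integrable_of_hasCompactSupport hgc.mul_left)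
    (fun z _ => hwa.differentiable (by norm_num) z)
    (fun z _ => hg.differentiable (by norm_num) z)
  rw [this]
  simp_rw [fderiv_affine hw, mul_assoc]
  rw [integral_const_mul]
  field_simp

lemma deriv_F {d : ℕ} {w : Euc d → ℝ} (hw : ContDiff ℝ 1 w) (x : Euc d) (r : ℝ) :
    HasDerivAt (fun r : ℝ => ∫ z, w (x + r • z) * phi z)
      (∫ z, fderiv ℝ w (x + r • z) z * phi z) r := by
  have hc : Continuous (fun q : ℝ × Euc d => fderiv ℝ w (x + q.1 • q.2) q.2 * phi q.2) := by
    have h1 := hw.continuous_fderiv (by norm_num)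
    have h2 : Continuous (phi (d := d)) := phi_contDiff.continuous
    exact ((h1.comp (by fun_prop : Continuous fun q : ℝ × Euc d => x + q.1 • q.2)).clm_apply
      continuous_snd).mul (h2.comp continuous_snd)
  obtain ⟨M, hM⟩ := ((isCompact_Icc (a := r - 1) (b := r + 1)).prod
    (isCompact_closedBall (0 : Euc d) 1)).exists_bound_of_continuousOn hc.continuousOn
  have hphi : Continuous (phi (d := d)) := phi_contDiff.continuous
  have hcw : ∀ r : ℝ, Continuous (fun z => w (x + r • z) * phi z) := fun r =>
    (hw.continuous.comp (affine_contDiff x r).continuous).mul hphi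
  refine (hasDerivAt_integral_of_dominated_loc_of_deriv_le (μ := volume) (𝕜 := ℝ)
    (s := Icc (r - 1) (r + 1))
    (F := fun r z => w (x + r • z) * phi z)
    (F' := fun r z => fderiv ℝ w (x + r • z) z * phi z)
    (bound := (Metric.closedBall (0 : Euc d) 1).indicator (fun _ => M))
    (Icc_mem_nhds (by linarith) (by linarith)) ?_ ?_ ?_ ?_ ?_ ?_).2
  · exact Eventually.of_forall fun r => (hcw r).aestronglyMeasurable
  · exact (hcw r).integrable_of_hasCompactSupport phi_compact.mul_left
  · exact (hc.comp (Continuous.prodMk_right r)).aestronglyMeasurable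
  · refine Eventually.of_forall fun z s hs => ?_
    by_cases hz : z ∈ Metric.closedBall (0 : Euc d) 1
    · rw [indicator_of_mem hz]
      exact hM (s, z) ⟨hs, hz⟩
    · rw [indicator_of_notMem hz, phi_zero_of z hz]
      simp
  · exact (integrable_indicator_iff Metric.isClosed_closedBall.measurableSet).2
      (integrableOn_const (isCompact_closedBall (0 : Euc d) 1).measure_lt_top.ne)
  · refine Eventually.of_forall fun z s _ => ?_
    refine HasDerivAt.mul_const ?_ _
    have h1 : HasDerivAt (fun s : ℝ => x + s • z) z s := by
      simpa using ((hasDerivAt_id s).smul_const z).const_add x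
    exact ((hw.differentiable (by norm_num)) (x + s • z)).hasFDerivAt.comp_hasDerivAt s h1

lemma abs_int_le {d : ℕ} {f g : Euc d → ℝ} {h : Euc d → ℝ} (hh : Continuous h)
    {K : ℝ} (hfh : ∀ y, |f y| ≤ h y)
    (hg : ∀ z, |g z| ≤ K) (hg0 : ∀ z, z ∉ Metric.closedBall (0 : Euc d) 1 → g z = 0)
    (x : Euc d) (r : ℝ) :
    |∫ z, f (x + r • z) * g z| ≤ K * ∫ z in Metric.closedBall (0 : Euc d) 1, h (x + r • z) := by
  rw [← integral_const_mul, ← integral_indicator Metric.isClosed_closedBall.measurableSet]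
  rw [← Real.norm_eq_abs]
  refine norm_integral_le_of_norm_le ?_ (Eventually.of_forall fun z => ?_)
  · refine (integrable_indicator_iff Metric.isClosed_closedBall.measurableSet).2 ?_
    have hc : Continuous (fun z : Euc d => K * h (x + r • z)) :=
      continuous_const.mul (hh.comp (affine_contDiff x r).continuous)
    exact hc.continuousOn.integrableOn_compact (isCompact_closedBall 0 1)
  · by_cases hz : z ∈ Metric.closedBall (0 : Euc d) 1
    · rw [indicator_of_mem hz, norm_mul, mul_comm K, Real.norm_eq_abs, Real.norm_eq_abs]
      exact mul_le_mul (hfh _) (hg z) (abs_nonneg _) ((abs_nonneg _).trans (hfh _))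
    · rw [indicator_of_notMem hz, hg0 z hz]
      simp

lemma eLpNorm_affine {d : ℕ} {f : Euc d → ℝ} (hf : Continuous f) (p : ℝ) (hp : 0 < p)
    (x : Euc d) {r : ℝ} (hr : 0 < r) :
    eLpNorm (fun z => f (x + r • z)) (ENNReal.ofReal p) volume =
      ENNReal.ofReal (r ^ (-((d : ℝ) / p))) * eLpNorm f (ENNReal.ofReal p) volume := by
  have hf2 : Continuous (fun y => f (x + y)) := by fun_prop
  have h1 : eLpNorm (fun y => f (x + y)) (ENNReal.ofReal p) volume =
      eLpNorm f (ENNReal.ofReal p) volume :=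
    eLpNorm_comp_measurePreserving hf.aestronglyMeasurable (measurePreserving_add_left volume x)
  have h2 := eLpNorm_map_measure (μ := (volume : Measure (Euc d))) (p := ENNReal.ofReal p)
    (f := fun z : Euc d => r • z) (g := fun y => f (x + y)) hf2.aestronglyMeasurable
    (continuous_const_smul r).measurable.aemeasurable
  have h3 : (fun z => f (x + r • z)) = (fun y => f (x + y)) ∘ (fun z : Euc d => r • z) := rfl
  rw [h3, ← h2, Measure.map_addHaar_smul _ hr.ne',
    eLpNorm_smul_measure_of_ne_top ENNReal.ofReal_ne_top, h1, smul_eq_mul]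
  congr 1
  rw [abs_of_pos (by positivity), finrank_euclideanSpace_fin, one_div, ENNReal.toReal_inv,
    ENNReal.toReal_ofReal hp.le, ENNReal.ofReal_rpow_of_nonneg (by positivity) (by positivity)]
  congr 1
  rw [← Real.rpow_natCast, ← Real.rpow_neg hr.le, ← Real.rpow_mul hr.le]
  congr 1
  ring

lemma holder_bound (d : ℕ) (p : ℝ) (hp : 1 ≤ p) : ∃ V : ℝ, 0 ≤ V ∧
    (∀ (f : Euc d → ℝ), Continuous f → (∀ y, 0 ≤ f y) →
      eLpNorm f (ENNReal.ofReal p) volume < ∞ → ∀ (x : Euc d) (r : ℝ), 0 < r →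
      ∫ z in Metric.closedBall (0 : Euc d) 1, f (x + r • z) ≤
        V * (eLpNorm f (ENNReal.ofReal p) volume).toReal * r ^ (-((d : ℝ) / p))) ∧
    ∀ W, 0 ≤ W → ∫ _ in Metric.closedBall (0 : Euc d) 1, W ≤ V * W := by
  set ν := (volume : Measure (Euc d)).restrict (Metric.closedBall (0 : Euc d) 1) with hν
  have hfin : ν univ < ∞ := by
    rw [hν, Measure.restrict_apply_univ]; exact (isCompact_closedBall (0 : Euc d) 1).measure_lt_top
  have hexp : (0:ℝ) ≤ 1 / (1 : ℝ≥0∞).toReal - 1 / (ENNReal.ofReal p).toReal := by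
    rw [ENNReal.toReal_one, ENNReal.toReal_ofReal (by linarith)]
    have : 1 / p ≤ 1 := by rw [div_le_one (by linarith)]; exact hp
    linarith
  set C := ν univ ^ (1 / (1 : ℝ≥0∞).toReal - 1 / (ENNReal.ofReal p).toReal) with hC
  have hCfin : C ≠ ∞ := ENNReal.rpow_ne_top_of_nonneg hexp hfin.ne
  refine ⟨max C.toReal (ν univ).toReal, le_max_of_le_left ENNReal.toReal_nonneg, ?_, ?_⟩
  · intro f hf hf0 hfp x r hr
    have hfa : Continuous (fun z => f (x + r • z)) := hf.comp (affine_contDiff x r).continuous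
    have h1 : eLpNorm (fun z => f (x + r • z)) 1 ν ≤
        ENNReal.ofReal (r ^ (-((d : ℝ) / p))) * eLpNorm f (ENNReal.ofReal p) volume * C := by
      refine (eLpNorm_le_eLpNorm_mul_rpow_measure_univ (q := ENNReal.ofReal p) ?_ ?_).trans ?_
      · simpa using hp
      · exact hfa.aestronglyMeasurable
      · refine mul_le_mul_left ?_ _
        rw [← eLpNorm_affine hf p (by linarith) x hr]
        exact eLpNorm_mono_measure _ Measure.restrict_le_self
    have h2 : ∫ z, f (x + r • z) ∂ν = (eLpNorm (fun z => f (x + r • z)) 1 ν).toReal := by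
      rw [eLpNorm_one_eq_lintegral_enorm, integral_eq_lintegral_of_nonneg_ae
        (Eventually.of_forall fun z => hf0 _) hfa.aestronglyMeasurable]
      congr 1
      refine lintegral_congr fun z => ?_
      rw [Real.enorm_of_nonneg (hf0 _)]
    have hrp := Real.rpow_nonneg hr.le (-((d : ℝ) / p))
    calc ∫ z, f (x + r • z) ∂ν ≤ (ENNReal.ofReal (r ^ (-((d : ℝ) / p))) *
          eLpNorm f (ENNReal.ofReal p) volume * C).toReal := by
          rw [h2]
          exact ENNReal.toReal_mono (ENNReal.mul_ne_top
            (ENNReal.mul_ne_top ENNReal.ofReal_ne_top hfp.ne) hCfin) h1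
      _ = C.toReal * (eLpNorm f (ENNReal.ofReal p) volume).toReal * r ^ (-((d : ℝ) / p)) := by
          rw [ENNReal.toReal_mul, ENNReal.toReal_mul, ENNReal.toReal_ofReal hrp]; ring
      _ ≤ _ := by
          gcongr
          exact le_max_left _ _
  · intro W hW
    rw [integral_const, smul_eq_mul]
    exact mul_le_mul_of_nonneg_right (le_max_right _ _) hW

lemma exists_K (d : ℕ) : ∃ K : ℝ, 0 ≤ K ∧ (∀ z : Euc d, |phi z| ≤ K) ∧
    (∀ i (z : Euc d), |gg i z| ≤ K) ∧
    ∀ i k (z : Euc d), |fderiv ℝ (gg i) z (ee k)| ≤ K := by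
  have h1 : ∀ i : Fin d, ∃ C, ∀ z : Euc d, |gg i z| ≤ C := fun i =>
    (gg_compact i).exists_bound_of_continuous (gg_contDiff i).continuous
  have h2 : ∀ i k : Fin d, ∃ C, ∀ z : Euc d, |fderiv ℝ (gg i) z (ee k)| ≤ C := fun i k =>
    ((gg_compact i).fderiv_apply ℝ (ee k)).exists_bound_of_continuous
      (((gg_contDiff i).continuous_fderiv (by norm_num)).clm_apply continuous_const)
  choose C1 hC1 using h1
  choose C2 hC2 using h2
  have n1 : ∀ i, 0 ≤ C1 i := fun i => (abs_nonneg _).trans (hC1 i 0)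
  have n2 : ∀ i k, 0 ≤ C2 i k := fun i k => (abs_nonneg _).trans (hC2 i k 0)
  have s1 : 0 ≤ ∑ i, C1 i := Finset.sum_nonneg fun i _ => n1 i
  have s2 : 0 ≤ ∑ i, ∑ k, C2 i k := Finset.sum_nonneg fun i _ => Finset.sum_nonneg fun k _ => n2 i k
  refine ⟨1 + ∑ i, C1 i + ∑ i, ∑ k, C2 i k, by positivity, ?_, ?_, ?_⟩
  · intro z
    have h0 : 0 ≤ phi z := Real.smoothTransition.nonneg _
    rw [abs_of_nonneg h0]
    have : phi z ≤ 1 := Real.smoothTransition.le_one _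
    linarith
  · intro i z
    have := Finset.single_le_sum (f := C1) (fun i _ => n1 i) (Finset.mem_univ i)
    linarith [hC1 i z]
  · intro i k z
    have := Finset.single_le_sum (f := fun k => C2 i k) (fun k _ => n2 i k) (Finset.mem_univ k)
    have := Finset.single_le_sum (f := fun i => ∑ k, C2 i k)
      (fun i _ => Finset.sum_nonneg fun k _ => n2 i k) (Finset.mem_univ i)
    linarith [hC2 i k z]

lemma fderiv_comp_entry {d : ℕ} {u : Euc d → Euc d} (hu : ContDiff ℝ 2 u) (b : Euc d) (i : Fin d)
    (y a : Euc d) :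
    fderiv ℝ (fun y => fderiv ℝ u y b i) y a = fderiv ℝ (fderiv ℝ u) y a b i := by
  have h1 : ContDiff ℝ 1 (fderiv ℝ u) := hu.fderiv_right (by norm_num)
  have h2 := ((h1.differentiable (by norm_num)) y).hasFDerivAt
  have h3 := ((EuclideanSpace.proj (𝕜 := ℝ) i).comp
    (ContinuousLinearMap.apply ℝ (Euc d) b)).hasFDerivAt.comp y h2
  have h4 : (fun y => fderiv ℝ u y b i) = ((EuclideanSpace.proj (𝕜 := ℝ) i).comp
    (ContinuousLinearMap.apply ℝ (Euc d) b)) ∘ fderiv ℝ u := rfl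
  rw [h4, h3.fderiv]
  rfl

lemma entry_contDiff {d : ℕ} {u : Euc d → Euc d} (hu : ContDiff ℝ 2 u) (b : Euc d) (i : Fin d) :
    ContDiff ℝ 1 (fun y => fderiv ℝ u y b i) := by
  have h1 : ContDiff ℝ 1 (fderiv ℝ u) := hu.fderiv_right (by norm_num)
  exact ((EuclideanSpace.proj (𝕜 := ℝ) i).comp
    (ContinuousLinearMap.apply ℝ (Euc d) b)).contDiff.comp h1

lemma curl_entry_contDiff {d : ℕ} {u : Euc d → Euc d} (hu : ContDiff ℝ 2 u) (i j : Fin d) :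
    ContDiff ℝ 1 (fun y => curlMat u y i j) :=
  (entry_contDiff hu (ee i) j).sub (entry_contDiff hu (ee j) i)

lemma fderiv_curl_entry {d : ℕ} {u : Euc d → Euc d} (hu : ContDiff ℝ 2 u) (i j : Fin d)
    (y a : Euc d) :
    fderiv ℝ (fun y => curlMat u y i j) y a =
      fderiv ℝ (fderiv ℝ u) y a (ee i) j - fderiv ℝ (fderiv ℝ u) y a (ee j) i := by
  rw [← fderiv_comp_entry hu, ← fderiv_comp_entry hu]
  have := fderiv_sub (x := y) ((entry_contDiff hu (ee i) j).differentiable (by norm_num) y)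
    ((entry_contDiff hu (ee j) i).differentiable (by norm_num) y)
  exact congrArg (fun T => T a) this

lemma vec_sum {d : ℕ} (z : Euc d) : z = ∑ i, z i • ee i := by
  ext j
  simp [ee, Finset.sum_apply, Pi.single_apply]

lemma entry_integrable {d : ℕ} {w g : Euc d → ℝ} (hw : ContDiff ℝ 1 w) (hg : Continuous g)
    (hgc : HasCompactSupport g) (x : Euc d) (r : ℝ) (e : Euc d) :
    Integrable (fun z => fderiv ℝ w (x + r • z) e * g z) := by
  have h1 : Continuous (fun z => fderiv ℝ w (x + r • z) e) :=
    ((hw.continuous_fderiv (by norm_num)).comp (affine_contDiff x r).continuous).clm_apply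
      continuous_const
  exact (h1.mul hg).integrable_of_hasCompactSupport hgc.mul_left

lemma key_identity {d : ℕ} {u : Euc d → Euc d} (hu : ContDiff ℝ 2 u) (hdiv : ∀ x, divg u x = 0)
    (x : Euc d) {r : ℝ} (hr : r ≠ 0) (k j : Fin d) :
    ∫ z, fderiv ℝ (fun y => fderiv ℝ u y (ee k) j) (x + r • z) z * phi z =
      ∑ i, ∫ z, fderiv ℝ (fun y => curlMat u y i j) (x + r • z) (ee k) * gg i z := by
  have sym : ∀ y a b, fderiv ℝ (fderiv ℝ u) y a b = fderiv ℝ (fderiv ℝ u) y b a := fun y a b =>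
    (hu.contDiffAt (x := y)).isSymmSndFDerivAt (by simp) a b
  -- the divergence term vanishes
  have hdiv2 : ∀ y, ∑ i, fderiv ℝ (fderiv ℝ u) y (ee i) (ee k) i = 0 := by
    intro y
    have h0 : (fun y => ∑ i, fderiv ℝ u y (ee i) i) = fun _ => (0 : ℝ) := funext hdiv
    have h1 : fderiv ℝ (fun y => ∑ i, fderiv ℝ u y (ee i) i) y (ee k) = 0 := by
      rw [h0]; simp
    rw [fderiv_fun_sum (fun i _ => (entry_contDiff hu (ee i) i).differentiable (by norm_num) y)] at h1
    rw [sum_apply] at h1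
    rw [← h1]
    refine Finset.sum_congr rfl fun i _ => ?_
    rw [fderiv_comp_entry hu, sym]
  have hzero : ∑ i, ∫ z, fderiv ℝ (fderiv ℝ u) (x + r • z) (ee k) (ee j) i * gg i z = 0 := by
    have h1 : ∀ i, ∫ z, fderiv ℝ (fderiv ℝ u) (x + r • z) (ee k) (ee j) i * gg i z =
        ∫ z, fderiv ℝ (fun y => fderiv ℝ u y (ee k) i) (x + r • z) (ee i) * gg j z := by
      intro i
      rw [ibp (entry_contDiff hu (ee k) i) (gg_contDiff j) (gg_compact j) x hr]
      simp_rw [gg_symm j i]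
      rw [← ibp (entry_contDiff hu (ee k) i) (gg_contDiff i) (gg_compact i) x hr]
      refine integral_congr_ae (Eventually.of_forall fun z => ?_)
      simp only
      rw [fderiv_comp_entry hu, sym]
    rw [Finset.sum_congr rfl fun i _ => h1 i, ← integral_finsetSum _ fun i _ =>
      entry_integrable (entry_contDiff hu (ee k) i) (gg_contDiff j).continuous (gg_compact j) x r _]
    simp_rw [← Finset.sum_mul, fderiv_comp_entry hu, hdiv2]
    simp
  have hmain : ∫ z, fderiv ℝ (fun y => fderiv ℝ u y (ee k) j) (x + r • z) z * phi z =
      ∑ i, ∫ z, fderiv ℝ (fun y => fderiv ℝ u y (ee i) j) (x + r • z) (ee k) * gg i z := by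
    rw [← integral_finsetSum _ fun i _ =>
      entry_integrable (entry_contDiff hu (ee i) j) (gg_contDiff i).continuous (gg_compact i) x r _]
    refine integral_congr_ae (Eventually.of_forall fun z => ?_)
    simp only
    have hz : ∀ T : Euc d →L[ℝ] ℝ, T z = ∑ i, T (z i • ee i) := fun T => by
      rw [← map_sum, ← vec_sum z]
    rw [hz, Finset.sum_mul]
    refine Finset.sum_congr rfl fun i _ => ?_
    rw [map_smul, fderiv_comp_entry hu, fderiv_comp_entry hu, sym, gg, smul_eq_mul]
    ring
  rw [hmain, ← sub_zero (∑ i, _), ← hzero, ← Finset.sum_sub_distrib]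
  refine Finset.sum_congr rfl fun i _ => ?_
  have e1 : ∀ z, fderiv ℝ (fderiv ℝ u) (x + r • z) (ee k) (ee j) i * gg i z =
      fderiv ℝ (fun y => fderiv ℝ u y (ee j) i) (x + r • z) (ee k) * gg i z := fun z => by
    rw [fderiv_comp_entry hu]
  simp_rw [e1]
  rw [← integral_sub
    (entry_integrable (entry_contDiff hu (ee i) j) (gg_contDiff i).continuous (gg_compact i) x r _)
    (entry_integrable (entry_contDiff hu (ee j) i) (gg_contDiff i).continuous (gg_compact i) x r _)]
  refine integral_congr_ae (Eventually.of_forall fun z => ?_)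
  simp only
  rw [fderiv_curl_entry hu, fderiv_comp_entry hu, fderiv_comp_entry hu]
  ring

/-- The vorticity as a continuous linear function of the gradient. -/
def curlL (d : ℕ) : (Euc d →L[ℝ] Euc d) →L[ℝ] (Fin d → Fin d → ℝ) :=
  ContinuousLinearMap.pi fun i => ContinuousLinearMap.pi fun j =>
    (EuclideanSpace.proj (𝕜 := ℝ) j).comp (ContinuousLinearMap.apply ℝ (Euc d) (ee i)) -
    (EuclideanSpace.proj (𝕜 := ℝ) i).comp (ContinuousLinearMap.apply ℝ (Euc d) (ee j))

lemma curl_eq {d : ℕ} (u : Euc d → Euc d) : curlMat u = curlL d ∘ fderiv ℝ u := by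
  funext x i j
  simp [curlMat, curlL]

lemma curl_contDiff {d : ℕ} {u : Euc d → Euc d} (hu : ContDiff ℝ 2 u) : ContDiff ℝ 1 (curlMat u) := by
  rw [curl_eq]
  exact (curlL d).contDiff.comp (hu.fderiv_right (by norm_num))

lemma ee_norm {d : ℕ} (i : Fin d) : ‖(ee i : Euc d)‖ = 1 := by simp [ee]

lemma curl_wNorm_lt_top {d : ℕ} {u : Euc d → Euc d} {p : ℝ} (hu : MemW 2 p u) :
    wNorm 0 1 p (curlMat u) < ∞ := by
  have h2 : ContDiff ℝ 2 u := hu.1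
  have hfin := hu.2
  unfold wNorm at *
  rw [ENNReal.sum_lt_top] at *
  intro n hn
  have hn' : n ≤ 1 := (Finset.mem_Icc.1 hn).2
  have := hfin (n + 1) (Finset.mem_Icc.2 ⟨by omega, by omega⟩)
  have hb : ∀ y, ‖iteratedFDeriv ℝ n (curlMat u) y‖ ≤ ‖curlL d‖ * ‖iteratedFDeriv ℝ (n+1) u y‖ := by
    intro y
    have h1 : ContDiff ℝ 1 (fderiv ℝ u) := h2.fderiv_right (by norm_num)
    rw [curl_eq, ← norm_iteratedFDeriv_fderiv]
    exact (curlL d).norm_iteratedFDeriv_comp_left h1.contDiffAt (by exact_mod_cast hn')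
  refine (eLpNorm_le_mul_eLpNorm_of_ae_le_mul (Eventually.of_forall hb) _).trans_lt ?_
  exact ENNReal.mul_lt_top ENNReal.ofReal_lt_top this

lemma clm_norm_le {d : ℕ} (T : Euc d →L[ℝ] Euc d) (M : ℝ) (hM : 0 ≤ M)
    (h : ∀ k j, |T (ee k) j| ≤ M) : ‖T‖ ≤ d * d * M := by
  refine T.opNorm_le_bound (by positivity) fun z => ?_
  have h1 : ∀ k, ‖T (ee k)‖ ≤ d * M := by
    intro k
    rw [vec_sum (T (ee k))]
    refine (norm_sum_le _ _).trans ((Finset.sum_le_card_nsmul _ _ M ?_).trans (by simp))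
    intro j _
    rw [norm_smul, ee_norm, mul_one]
    exact h k j
  conv_lhs => rw [vec_sum z, map_sum]
  refine (norm_sum_le _ _).trans
    ((Finset.sum_le_card_nsmul _ _ (‖z‖ * (d * M)) ?_).trans (le_of_eq (by simp; ring)))
  intro k _
  rw [map_smul, norm_smul]
  exact mul_le_mul (PiLp.norm_apply_le z k) (h1 k) (norm_nonneg _) (norm_nonneg _)

lemma pointwise_bound (d : ℕ) (hd : 2 ≤ d) (p : ℝ) (hp : (d : ℝ) < p) :
    ∃ A : ℝ, 0 ≤ A ∧ ∀ u : Euc d → Euc d, MemW 2 p u → (∀ x, divg u x = 0) →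
      ∀ W : ℝ, (∀ x, ‖curlMat u x‖ ≤ W) → ∀ x k j,
        |fderiv ℝ u x (ee k) j| ≤
          A * ((1 + max (Real.log ((wNorm 0 1 p (curlMat u)).toReal)) 0) * (1 + W)) := by
  have hd0 : (0:ℝ) < d := by positivity
  have hp0 : 0 < p := hd0.trans hp
  have hp1 : 1 ≤ p := by
    have : (2:ℝ) ≤ d := by exact_mod_cast hd
    linarith
  obtain ⟨V, hV0, hV1, hV2⟩ := holder_bound d p hp1
  obtain ⟨K, hK0, hKphi, hKg, hKdg⟩ := exists_K d
  set b := (d : ℝ) / p with hb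
  have hb0 : 0 < b := div_pos hd0 hp0
  have hb1 : b < 1 := (div_lt_one hp0).2 hp
  have ha0 : 0 < 1 - b := by linarith
  set m := ∫ z : Euc d, phi z with hm
  have hm0 : 0 < m := phi_integral_pos
  set A := d * (K * V) with hA
  have hA0 : 0 ≤ A := by positivity
  set q := 1 / (1 - b) + 1 / b with hq
  have hq0 : 0 < q := by positivity
  refine ⟨m⁻¹ * (A * q), by positivity, ?_⟩
  intro u hu hdiv W hW x k j
  have hW0 : 0 ≤ W := (norm_nonneg _).trans (hW 0)
  have hu2 : ContDiff ℝ 2 u := hu.1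
  have hcurl := curl_contDiff hu2
  have hfin := curl_wNorm_lt_top hu
  set N0 := (wNorm 0 1 p (curlMat u)).toReal with hN0
  set N := max N0 1 with hN
  have hN1 : 1 ≤ N := le_max_right _ _
  -- norms
  have hsum : wNorm 0 1 p (curlMat u) =
      eLpNorm (fun y => ‖curlMat u y‖) (ENNReal.ofReal p) volume +
      eLpNorm (fun y => ‖fderiv ℝ (curlMat u) y‖) (ENNReal.ofReal p) volume := by
    unfold wNorm
    rw [show Finset.Icc 0 1 = {0, 1} from rfl, Finset.sum_pair (by norm_num)]
    congr 1
    · refine eLpNorm_congr_norm_ae (Eventually.of_forall fun y => ?_)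
      simp
    · refine eLpNorm_congr_norm_ae (Eventually.of_forall fun y => ?_)
      rw [norm_iteratedFDeriv_one, norm_norm]
  rw [hsum] at hfin
  have hf0 : eLpNorm (fun y => ‖curlMat u y‖) (ENNReal.ofReal p) volume < ∞ :=
    lt_of_le_of_lt le_self_add hfin
  have hf1 : eLpNorm (fun y => ‖fderiv ℝ (curlMat u) y‖) (ENNReal.ofReal p) volume < ∞ :=
    lt_of_le_of_lt le_add_self hfin
  have hle0 : (eLpNorm (fun y => ‖curlMat u y‖) (ENNReal.ofReal p) volume).toReal ≤ N := by
    refine le_trans ?_ (le_max_left _ _)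
    rw [hN0, hsum]
    exact ENNReal.toReal_mono hfin.ne le_self_add
  have hle1 : (eLpNorm (fun y => ‖fderiv ℝ (curlMat u) y‖) (ENNReal.ofReal p) volume).toReal ≤ N := by
    refine le_trans ?_ (le_max_left _ _)
    rw [hN0, hsum]
    exact ENNReal.toReal_mono hfin.ne le_add_self
  have hc0 : Continuous (fun y => ‖curlMat u y‖) := hcurl.continuous.norm
  have hc1 : Continuous (fun y => ‖fderiv ℝ (curlMat u) y‖) :=
    (hcurl.continuous_fderiv (by norm_num)).norm
  have hent0 : ∀ i y, |curlMat u y i j| ≤ ‖curlMat u y‖ := fun i y =>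
    (norm_le_pi_norm (curlMat u y i) j).trans (norm_le_pi_norm (curlMat u y) i)
  have hent1 : ∀ i y, |fderiv ℝ (fun y => curlMat u y i j) y (ee k)| ≤ ‖fderiv ℝ (curlMat u) y‖ := by
    intro i y
    have h1 := ((hcurl.differentiable (by norm_num)) y).hasFDerivAt
    have h2 := (hasFDerivAt_pi'.1 (hasFDerivAt_pi'.1 h1 i)) j
    rw [h2.fderiv]
    refine le_trans ?_ ((fderiv ℝ (curlMat u) y).le_opNorm (ee k) |>.trans (by rw [ee_norm, mul_one]))
    exact (norm_le_pi_norm (fderiv ℝ (curlMat u) y (ee k) i) j).trans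
      (norm_le_pi_norm (fderiv ℝ (curlMat u) y (ee k)) i)
  set v : Euc d → ℝ := fun y => fderiv ℝ u y (ee k) j with hv
  have hvC : ContDiff ℝ 1 v := entry_contDiff hu2 _ _
  set F : ℝ → ℝ := fun r => ∫ z, v (x + r • z) * phi z with hF
  set F' : ℝ → ℝ := fun r => ∫ z, fderiv ℝ v (x + r • z) z * phi z with hF'
  have key : ∀ r, 0 < r → F' r =
      ∑ i, ∫ z, fderiv ℝ (fun y => curlMat u y i j) (x + r • z) (ee k) * gg i z :=
    fun r hr => key_identity hu2 hdiv x hr.ne' k j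
  have sumb : ∀ (G : Fin d → ℝ) (B : ℝ), (∀ i, |G i| ≤ B) → |∑ i, G i| ≤ d * B := by
    intro G B hG
    exact (Finset.abs_sum_le_sum_abs _ _).trans
      ((Finset.sum_le_card_nsmul _ _ B fun i _ => hG i).trans (by simp))
  have hdgb : ∀ r, 0 < r → ∀ B, (∫ z in Metric.closedBall (0 : Euc d) 1, ‖curlMat u (x + r • z)‖) ≤ B →
      |F' r| ≤ d * (r⁻¹ * (K * B)) := by
    intro r hr B hB
    rw [key r hr]
    refine sumb _ _ fun i => ?_
    rw [ibp (curl_entry_contDiff hu2 i j) (gg_contDiff i) (gg_compact i) x hr.ne', abs_neg, abs_mul,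
      abs_of_pos (inv_pos.2 hr)]
    refine mul_le_mul_of_nonneg_left ?_ (inv_pos.2 hr).le
    refine (abs_int_le (f := fun y => curlMat u y i j) hc0 (hent0 i) (hKdg i k)
      (dgg_zero_of i (ee k)) x r).trans ?_
    exact mul_le_mul_of_nonneg_left hB hK0
  have b1 : ∀ r, 0 < r → |F' r| ≤ A * N * r ^ (-b) := by
    intro r hr
    have hrp := Real.rpow_nonneg hr.le (-b)
    rw [key r hr]
    refine (sumb _ (K * (V * N * r ^ (-b))) fun i => ?_).trans (le_of_eq (by rw [hA]; ring))
    refine (abs_int_le (f := fun y => fderiv ℝ (fun y => curlMat u y i j) y (ee k)) hc1 (hent1 i)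
      (hKg i) (gg_zero_of i) x r).trans ?_
    refine mul_le_mul_of_nonneg_left ?_ hK0
    refine (hV1 _ hc1 (fun y => norm_nonneg _) hf1 x r hr).trans ?_
    gcongr
  have b2 : ∀ r, 0 < r → |F' r| ≤ A * W * r⁻¹ := by
    intro r hr
    refine (hdgb r hr (V * W) ?_).trans (le_of_eq (by rw [hA]; ring))
    refine le_trans ?_ (hV2 W hW0)
    refine setIntegral_mono ?_ ?_ fun z => hW _
    · exact (hc0.comp (affine_contDiff x r).continuous).continuousOn.integrableOn_compact
        (isCompact_closedBall (0 : Euc d) 1)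
    · exact (continuous_const).continuousOn.integrableOn_compact
        (isCompact_closedBall (0 : Euc d) 1)
  have b3 : ∀ r, 0 < r → |F' r| ≤ A * N * r ^ (-b - 1) := by
    intro r hr
    have hrp := Real.rpow_nonneg hr.le (-b)
    refine (hdgb r hr (V * N * r ^ (-b)) ?_).trans (le_of_eq ?_)
    · refine (hV1 _ hc0 (fun y => norm_nonneg _) hf0 x r hr).trans ?_
      gcongr
    · rw [Real.rpow_sub_one hr.ne', hA]; ring
  have hlim : Tendsto F atTop (𝓝 0) := by
    have hg : eLpNorm (fun y => ‖fderiv ℝ u y‖) (ENNReal.ofReal p) volume < ∞ := by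
      have h1 := hu.2
      unfold wNorm at h1
      rw [ENNReal.sum_lt_top] at h1
      have h2 := h1 1 (by simp)
      refine lt_of_eq_of_lt (eLpNorm_congr_norm_ae (Eventually.of_forall fun y => ?_)) h2
      rw [norm_iteratedFDeriv_one, norm_norm]
    have hcu : Continuous (fun y => ‖fderiv ℝ u y‖) := (hu2.continuous_fderiv (by norm_num)).norm
    have hvb : ∀ y, |v y| ≤ ‖fderiv ℝ u y‖ := by
      intro y
      refine (PiLp.norm_apply_le (fderiv ℝ u y (ee k)) j).trans ?_
      exact ((fderiv ℝ u y).le_opNorm (ee k)).trans (by rw [ee_norm, mul_one])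
    have hFb : ∀ r, 0 < r → |F r| ≤ K * (V *
        (eLpNorm (fun y => ‖fderiv ℝ u y‖) (ENNReal.ofReal p) volume).toReal * r ^ (-b)) := by
      intro r hr
      refine (abs_int_le hcu hvb hKphi phi_zero_of x r).trans ?_
      exact mul_le_mul_of_nonneg_left (hV1 _ hcu (fun y => norm_nonneg _) hg x r hr) hK0
    have ht : Tendsto (fun r : ℝ => K * (V *
        (eLpNorm (fun y => ‖fderiv ℝ u y‖) (ENNReal.ofReal p) volume).toReal * r ^ (-b)))
        atTop (𝓝 0) := by
      have := ((tendsto_rpow_neg_atTop hb0).const_mul (V *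
        (eLpNorm (fun y => ‖fderiv ℝ u y‖) (ENNReal.ofReal p) volume).toReal)).const_mul K
      simpa using this
    refine squeeze_zero_norm' ?_ ht
    filter_upwards [eventually_gt_atTop 0] with r hr using hFb r hr
  have hfinal := core_bound F F' A W N b hA0 hN1 hb0 hb1 (fun r => deriv_F hvC x r) b1 b2 b3 hlim
  have hF0 : F 0 = v x * m := by
    simp only [hF, zero_smul, add_zero]
    rw [integral_const_mul]
  have hlog : Real.log N = max (Real.log N0) 0 := by
    have hN00 : 0 ≤ N0 := ENNReal.toReal_nonneg
    rcases le_total N0 1 with h | h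
    · rw [hN, max_eq_right h, Real.log_one, max_eq_right (Real.log_nonpos hN00 h)]
    · rw [hN, max_eq_left h, max_eq_left (Real.log_nonneg h)]
  rw [← hlog]
  have hlog0 : 0 ≤ Real.log N := Real.log_nonneg hN1
  rw [hF0, abs_mul, abs_of_pos hm0] at hfinal
  have e1 : |v x| = m⁻¹ * (|v x| * m) := by field_simp
  rw [e1, mul_assoc]
  refine mul_le_mul_of_nonneg_left (hfinal.trans ?_) (inv_pos.2 hm0).le
  rw [mul_assoc A q]
  refine mul_le_mul_of_nonneg_left ?_ hA0
  have : 1 / (1 - b) + W * (q * Real.log N) + 1 / b = q * (1 + W * Real.log N) := by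
    rw [hq]; ring
  rw [this]
  refine mul_le_mul_of_nonneg_left ?_ hq0.le
  nlinarith

/-- Beale–Kato–Majda type logarithmic estimate. For `p > d` there is
`c = c(p,d)` such that for every divergence-free `u ∈ W^{2,p}(ℝ^d;ℝ^d)` with vorticity
`ω = curl u`: `‖∇u‖_∞ ≤ c (1 + log⁺ ‖ω‖_{1,p})(1 + ‖ω‖_∞)`. -/
theorem beale_kato_majda (d : ℕ) (hd : 2 ≤ d) (p : ℝ) (hp : (d : ℝ) < p) :
    ∃ c : ℝ≥0, 0 < c ∧ ∀ u : Euc d → Euc d, MemW 2 p u → (∀ x, divg u x = 0) →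
      supNorm (fderiv ℝ u) ≤
        (c : ℝ≥0∞) *
          (1 + ENNReal.ofReal (max (Real.log ((wNorm 0 1 p (curlMat u)).toReal)) 0)) *
          (1 + supNorm (curlMat u)) := by
  obtain ⟨A, hA0, hA⟩ := pointwise_bound d hd p hp
  set C : ℝ := d * d * A + 1 with hC
  have hC0 : 0 < C := by positivity
  refine ⟨C.toNNReal, Real.toNNReal_pos.2 hC0, ?_⟩
  intro u hu hdiv
  set l := max (Real.log ((wNorm 0 1 p (curlMat u)).toReal)) 0 with hl
  have hl0 : 0 ≤ l := le_max_right _ _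
  by_cases htop : supNorm (curlMat u) = ∞
  · rw [htop, add_top, ENNReal.mul_top]
    · exact le_top
    · refine mul_ne_zero ?_ ?_
      · exact_mod_cast (Real.toNNReal_pos.2 hC0).ne'
      · exact (lt_of_lt_of_le one_pos le_self_add).ne'
  set W := (supNorm (curlMat u)).toReal with hW
  have hW0 : 0 ≤ W := ENNReal.toReal_nonneg
  have hWb : ∀ x, ‖curlMat u x‖ ≤ W := by
    intro x
    have h1 : (‖curlMat u x‖₊ : ℝ≥0∞) ≤ supNorm (curlMat u) :=
      le_iSup (fun x => (‖curlMat u x‖₊ : ℝ≥0∞)) x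
    have := ENNReal.toReal_mono htop h1
    simpa using this
  have hS : supNorm (curlMat u) = ENNReal.ofReal W := (ENNReal.ofReal_toReal htop).symm
  have hR : (C.toNNReal : ℝ≥0∞) * (1 + ENNReal.ofReal l) * (1 + supNorm (curlMat u)) =
      ENNReal.ofReal (C * (1 + l) * (1 + W)) := by
    rw [hS, ENNReal.ofReal_mul (by positivity), ENNReal.ofReal_mul hC0.le,
      ENNReal.ofReal_add zero_le_one hl0, ENNReal.ofReal_add zero_le_one hW0, ENNReal.ofReal_one]
    rfl
  rw [hR]
  refine iSup_le fun x => ?_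
  have h1 := clm_norm_le (fderiv ℝ u x) (A * ((1 + l) * (1 + W))) (by positivity)
    (fun k j => hA u hu hdiv W hWb x k j)
  have h2 : ‖fderiv ℝ u x‖ ≤ C * (1 + l) * (1 + W) := by
    refine h1.trans ?_
    have : 0 ≤ (1 + l) * (1 + W) := by positivity
    rw [hC]
    nlinarith
  have h3 : (‖fderiv ℝ u x‖₊ : ℝ≥0∞) = ENNReal.ofReal ‖fderiv ℝ u x‖ :=
    (ofReal_norm _).symm
  rw [h3]
  exact ENNReal.ofReal_le_ofReal h2
end
end
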